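/- arXiv:1107.0802 — 6 statements merged into one kernel-verified Lean document; each statement's English description precedes it below -/
import Mathlib

section
/- Let Λ > 0 and let h₀ ∈ C^k([0,∞)) for some k ≥ 1. Then the characteristic initial value problem Dh = −(Λ/3) r (h − h̄) on [0,∞)×[0,∞), h(0,r) = h₀(r), has a unique solution h ∈ C^k([0,∞)×[0,∞)). -/
open Real Set

/-- The spherical mean `h̄(u,r) = (1/r) ∫₀^r h(u,s) ds`, with `h̄(u,0) = h(u,0)`. -/
noncomputable def hbar (h : ℝ → ℝ → ℝ) (u r : ℝ) : ℝ :=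
  if r = 0 then h u 0 else (∫ s in (0:ℝ)..r, h u s) / r

/-- Partial derivative in the `u` direction (within `[0,∞)`). -/
noncomputable def pderivU (h : ℝ → ℝ → ℝ) (u r : ℝ) : ℝ :=
  derivWithin (fun u' => h u' r) (Set.Ici 0) u

/-- Partial derivative in the `r` direction (within `[0,∞)`). -/
noncomputable def pderivR (h : ℝ → ℝ → ℝ) (u r : ℝ) : ℝ :=
  derivWithin (fun r' => h u r') (Set.Ici 0) r

/-- `h` solves `Dh = -(Λ/3) r (h - h̄)` on `[0,∞) × [0,∞)`, where
`D = ∂_u - (1/2)(1 - (Λ/3) r²) ∂_r`. -/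
def IsSol (Λ : ℝ) (h : ℝ → ℝ → ℝ) : Prop :=
  ∀ u r : ℝ, 0 ≤ u → 0 ≤ r →
    pderivU h u r - (1/2) * (1 - Λ/3 * r^2) * pderivR h u r
      = -(Λ/3) * r * (h u r - hbar h u r)

/-- `h` is differentiable in each variable on the closed quadrant and satisfies the equation
`Dh = -(Λ/3) (r h - ∫₀^r h)` there. -/
def HasPartialsSolving (Λ : ℝ) (h : ℝ → ℝ → ℝ) : Prop :=
  ∀ u r : ℝ, 0 ≤ u → 0 ≤ r → ∃ a b : ℝ,
    HasDerivWithinAt (fun u' => h u' r) a (Ici 0) u ∧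
    HasDerivWithinAt (fun r' => h u r') b (Ici 0) r ∧
    a - (1/2) * (1 - Λ/3 * r^2) * b = -(Λ/3) * (r * h u r - ∫ s in (0:ℝ)..r, h u s)

lemma mul_hbar (h : ℝ → ℝ → ℝ) (u r : ℝ) : r * hbar h u r = ∫ s in (0:ℝ)..r, h u s := by
  unfold hbar
  split_ifs with hr
  · simp [hr]
  · field_simp

lemma HasPartialsSolving.isSol {Λ : ℝ} {h : ℝ → ℝ → ℝ} (H : HasPartialsSolving Λ h) :
    IsSol Λ h := by
  intro u r hu hr
  obtain ⟨a, b, ha, hb, hab⟩ := H u r hu hr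
  have e1 : pderivU h u r = a := ha.derivWithin (uniqueDiffOn_Ici 0 u hu)
  have e2 : pderivR h u r = b := hb.derivWithin (uniqueDiffOn_Ici 0 r hr)
  rw [e1, e2, hab, ← mul_hbar]
  ring

lemma IsSol.hasPartialsSolving {Λ : ℝ} {h : ℝ → ℝ → ℝ} (H : IsSol Λ h)
    (hd : DifferentiableOn ℝ (fun p : ℝ × ℝ => h p.1 p.2) (Ici 0 ×ˢ Ici 0)) :
    HasPartialsSolving Λ h := by
  intro u r hu hr
  refine ⟨pderivU h u r, pderivR h u r, ?_, ?_, ?_⟩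
  · refine DifferentiableWithinAt.hasDerivWithinAt ?_
    exact (hd (u, r) ⟨hu, hr⟩).comp (f := fun u' : ℝ => (u', r)) u
      (by fun_prop) (fun x hx => ⟨hx, hr⟩)
  · refine DifferentiableWithinAt.hasDerivWithinAt ?_
    exact (hd (u, r) ⟨hu, hr⟩).comp (f := fun r' : ℝ => (u, r')) r
      (by fun_prop) (fun x hx => ⟨hu, hx⟩)
  · rw [H u r hu hr, ← mul_hbar]
    ring

lemma continuousOn_slice {h : ℝ → ℝ → ℝ}
    (hc : ContinuousOn (fun p : ℝ × ℝ => h p.1 p.2) (Ici 0 ×ˢ Ici 0)) {u : ℝ} (hu : 0 ≤ u) :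
    ContinuousOn (h u) (Ici 0) :=
  hc.comp (f := fun r' : ℝ => (u, r')) (by fun_prop) (fun _ hx => ⟨hu, hx⟩)

lemma intervalIntegrable_slice {h : ℝ → ℝ → ℝ}
    (hc : ContinuousOn (fun p : ℝ × ℝ => h p.1 p.2) (Ici 0 ×ˢ Ici 0)) {u r : ℝ}
    (hu : 0 ≤ u) (hr : 0 ≤ r) :
    IntervalIntegrable (h u) MeasureTheory.volume 0 r := by
  apply ContinuousOn.intervalIntegrable
  rw [uIcc_of_le hr]
  exact (continuousOn_slice hc hu).mono Icc_subset_Ici_self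

lemma HasPartialsSolving.sub {Λ : ℝ} {f g : ℝ → ℝ → ℝ}
    (hf : HasPartialsSolving Λ f) (hg : HasPartialsSolving Λ g)
    (cf : ContinuousOn (fun p : ℝ × ℝ => f p.1 p.2) (Ici 0 ×ˢ Ici 0))
    (cg : ContinuousOn (fun p : ℝ × ℝ => g p.1 p.2) (Ici 0 ×ˢ Ici 0)) :
    HasPartialsSolving Λ (fun u r => f u r - g u r) := by
  intro u r hu hr
  obtain ⟨a, b, ha, hb, hab⟩ := hf u r hu hr
  obtain ⟨a', b', ha', hb', hab'⟩ := hg u r hu hr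
  refine ⟨a - a', b - b', ha.sub ha', hb.sub hb', ?_⟩
  rw [intervalIntegral.integral_sub (intervalIntegrable_slice cf hu hr)
    (intervalIntegrable_slice cg hu hr)]
  linear_combination hab - hab'

lemma HasDerivWithinAt.nonneg_of_isMaxOn_Icc_left {f : ℝ → ℝ} {f' a x : ℝ}
    (hf : HasDerivWithinAt f f' (Ici a) x) (hax : a < x)
    (hmax : ∀ y ∈ Icc a x, f y ≤ f x) : 0 ≤ f' := by
  have h1 : HasDerivWithinAt f f' (Iio x) x :=
    (hf.hasDerivAt (Ici_mem_nhds hax)).hasDerivWithinAt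
  have h2 := (hasDerivWithinAt_iff_tendsto_slope' (by simp)).1 h1
  refine ge_of_tendsto h2 ?_
  filter_upwards [Ioo_mem_nhdsLT hax] with y hy
  rw [slope_def_field]
  exact div_nonneg_of_nonpos (by linarith [hmax y ⟨hy.1.le, hy.2.le⟩]) (by linarith [hy.2])

lemma HasDerivWithinAt.nonpos_of_isMaxOn_Icc_right {f : ℝ → ℝ} {f' a x b : ℝ}
    (hf : HasDerivWithinAt f f' (Ici a) x) (hax : a ≤ x) (hxb : x < b)
    (hmax : ∀ y ∈ Icc x b, f y ≤ f x) : f' ≤ 0 := by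
  have h1 : HasDerivWithinAt f f' (Ioi x) x :=
    hf.mono (fun y hy => hax.trans (le_of_lt hy))
  have h2 := (hasDerivWithinAt_iff_tendsto_slope' (by simp)).1 h1
  refine le_of_tendsto h2 ?_
  filter_upwards [Ioo_mem_nhdsGT hxb] with y hy
  rw [slope_def_field]
  exact div_nonpos_of_nonpos_of_nonneg (by linarith [hmax y ⟨hy.1.le, hy.2.le⟩])
    (by linarith [hy.1])

/-- Maximum principle: a solution that is nonpositive at `u = 0` stays nonpositive. -/
lemma HasPartialsSolving.nonpos {Λ : ℝ} (hΛ : 0 < Λ) {w : ℝ → ℝ → ℝ}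
    (hw : HasPartialsSolving Λ w)
    (cw : ContinuousOn (fun p : ℝ × ℝ => w p.1 p.2) (Ici 0 ×ˢ Ici 0))
    (h0 : ∀ r, 0 ≤ r → w 0 r ≤ 0) {u r : ℝ} (hu : 0 ≤ u) (hr : 0 ≤ r) : w u r ≤ 0 := by
  set R : ℝ := max r (1 + 3 / Λ) with hR
  have hrR : r ≤ R := le_max_left _ _
  have hR1 : 1 + 3 / Λ ≤ R := le_max_right _ _
  have hRpos : 0 ≤ R := hr.trans hrR
  have hVR : 1 < Λ / 3 * R ^ 2 := by
    have h3 : 0 < 3 / Λ := by positivity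
    have : 3 / Λ < R ^ 2 := by nlinarith
    rw [div_lt_iff₀ hΛ] at this
    linarith
  have hcomp : IsCompact (Icc 0 u ×ˢ Icc 0 R) := isCompact_Icc.prod isCompact_Icc
  have hcont : ContinuousOn (fun p : ℝ × ℝ => exp (-p.1) * w p.1 p.2) (Icc 0 u ×ˢ Icc 0 R) :=
    ContinuousOn.mul (by fun_prop)
      (cw.mono (prod_mono Icc_subset_Ici_self Icc_subset_Ici_self))
  obtain ⟨⟨v, s⟩, ⟨⟨hv0, hvu⟩, hs0, hsR⟩, hmax⟩ :=
    hcomp.exists_isMaxOn ⟨(u, r), ⟨hu, le_rfl⟩, hr, hrR⟩ hcont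
  simp only at hv0 hvu hs0 hsR
  have hmax' : ∀ x y, 0 ≤ x → x ≤ u → 0 ≤ y → y ≤ R → exp (-x) * w x y ≤ exp (-v) * w v s :=
    fun x y hx hxu hy hyR => hmax (show (x, y) ∈ Icc 0 u ×ˢ Icc 0 R from ⟨⟨hx, hxu⟩, hy, hyR⟩)
  have hslice : ∀ y, 0 ≤ y → y ≤ R → w v y ≤ w v s := fun y hy hyR =>
    le_of_mul_le_mul_left (hmax' v y hv0 hvu hy hyR) (exp_pos _)
  suffices hle : w v s ≤ 0 by
    have h1 := hmax' u r hu le_rfl hr hrR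
    have h2 : exp (-v) * w v s ≤ 0 := mul_nonpos_of_nonneg_of_nonpos (exp_pos _).le hle
    by_contra! hpos
    linarith [mul_pos (exp_pos (-u)) hpos]
  by_contra! hpos
  have hvpos : 0 < v := by
    rcases hv0.eq_or_lt with h | h
    · rw [← h] at hpos
      linarith [h0 s hs0]
    · exact h
  obtain ⟨a, b, ha, hb, hab⟩ := hw v s hv0 hs0
  have hda : 0 ≤ -exp (-v) * w v s + exp (-v) * a := by
    have he : HasDerivWithinAt (fun x : ℝ => exp (-x)) (-exp (-v)) (Ici 0) v := by
      simpa using ((hasDerivAt_id v).neg.exp).hasDerivWithinAt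
    exact (he.mul ha).nonneg_of_isMaxOn_Icc_left hvpos
      (fun y hy => hmax' y s hy.1 (hy.2.trans hvu) hs0 hsR)
  have hwa : w v s ≤ a := by
    have : 0 ≤ exp (-v) * (a - w v s) := by linarith
    linarith [nonneg_of_mul_nonneg_right this (exp_pos _)]
  have hVb : (1 - Λ / 3 * s ^ 2) * b ≤ 0 := by
    rcases lt_trichotomy (1 - Λ / 3 * s ^ 2) 0 with hV | hV | hV
    · have hs : 0 < s := by
        rcases hs0.eq_or_lt with h | h
        · rw [← h] at hV
          norm_num at hV
        · exact h
      have := hb.nonneg_of_isMaxOn_Icc_left hs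
        (fun y hy => hslice y hy.1 (hy.2.trans hsR))
      exact mul_nonpos_of_nonpos_of_nonneg hV.le this
    · simp [hV]
    · have hs : s < R := by
        by_contra! hRs
        have : R ^ 2 ≤ s ^ 2 := pow_le_pow_left₀ hRpos hRs 2
        nlinarith
      have := hb.nonpos_of_isMaxOn_Icc_right hs0 hs
        (fun y hy => hslice y (hs0.trans hy.1) hy.2)
      exact mul_nonpos_of_nonneg_of_nonpos hV.le this
  have hint : ∫ y in (0:ℝ)..s, w v y ≤ s * w v s := by
    have := intervalIntegral.integral_mono_on hs0 (intervalIntegrable_slice cw hv0 hs0)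
      (intervalIntegrable_const (c := w v s)) (fun y hy => hslice y hy.1 (hy.2.trans hsR))
    simpa using this
  have : 0 ≤ Λ / 3 * (s * w v s - ∫ y in (0:ℝ)..s, w v y) :=
    mul_nonneg (by positivity) (by linarith)
  linarith

lemma HasPartialsSolving.unique {Λ : ℝ} (hΛ : 0 < Λ) {f g : ℝ → ℝ → ℝ}
    (hf : HasPartialsSolving Λ f) (hg : HasPartialsSolving Λ g)
    (cf : ContinuousOn (fun p : ℝ × ℝ => f p.1 p.2) (Ici 0 ×ˢ Ici 0))
    (cg : ContinuousOn (fun p : ℝ × ℝ => g p.1 p.2) (Ici 0 ×ˢ Ici 0))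
    (h0 : ∀ r, 0 ≤ r → f 0 r = g 0 r) {u r : ℝ} (hu : 0 ≤ u) (hr : 0 ≤ r) :
    f u r = g u r := by
  have h1 := (hf.sub hg cf cg).nonpos hΛ (cf.sub cg) (fun r hr => by simp [h0 r hr]) hu hr
  have h2 := (hg.sub hf cg cf).nonpos hΛ (cg.sub cf) (fun r hr => by simp [h0 r hr]) hu hr
  linarith

lemma hasDerivWithinAt_integral_Ici {f : ℝ → ℝ} (hf : ContinuousOn f (Ici 0)) {x : ℝ}
    (hx : 0 ≤ x) : HasDerivWithinAt (fun y => ∫ s in (0:ℝ)..y, f s) (f x) (Ici 0) x := by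
  have hc : Continuous (fun s => f (max 0 s)) :=
    hf.comp_continuous (by fun_prop) (fun s => le_max_left 0 s)
  have h1 : HasDerivWithinAt (fun y => ∫ s in (0:ℝ)..y, f (max 0 s)) (f (max 0 x)) (Ici 0) x :=
    (hc.integral_hasStrictDerivAt 0 x).hasDerivAt.hasDerivWithinAt
  rw [max_eq_right hx] at h1
  have heq : ∀ y ∈ Ici (0:ℝ), ∫ s in (0:ℝ)..y, f s = ∫ s in (0:ℝ)..y, f (max 0 s) := by
    intro y hy
    refine intervalIntegral.integral_congr (fun s hs => ?_)
    rw [uIcc_of_le hy] at hs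
    simp only [max_eq_right hs.1]
  exact h1.congr heq (heq x hx)

lemma contDiffOn_integral_Ici {f : ℝ → ℝ} {k : ℕ} (hf : ContDiffOn ℝ k f (Ici 0)) :
    ContDiffOn ℝ k (fun y => ∫ s in (0:ℝ)..y, f s) (Ici 0) := by
  have hd := fun x (hx : x ∈ Ici (0:ℝ)) => hasDerivWithinAt_integral_Ici hf.continuousOn hx
  have : ContDiffOn ℝ (k + 1) (fun y => ∫ s in (0:ℝ)..y, f s) (Ici 0) := by
    rw [contDiffOn_succ_iff_derivWithin (uniqueDiffOn_Ici 0)]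
    refine ⟨fun x hx => (hd x hx).differentiableWithinAt, by simp, ?_⟩
    exact hf.congr (fun x hx => (hd x hx).derivWithin (uniqueDiffOn_Ici 0 x hx))
  exact this.of_le (by exact_mod_cast Nat.le_succ k)

/-- The solution of `c' = (1 - l c²) / 2`, `c 0 = 0`, for `l > 0`: the point at which the
characteristic through `(u, 0)` meets `u = 0`. -/
noncomputable def centerFoot (l u : ℝ) : ℝ :=
  (1 - exp (-(√l * u))) / (√l * (1 + exp (-(√l * u))))

lemma centerFoot_zero (l : ℝ) : centerFoot l 0 = 0 := by simp [centerFoot]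

lemma centerFoot_nonneg {l u : ℝ} (hu : 0 ≤ u) : 0 ≤ centerFoot l u := by
  have : exp (-(√l * u)) ≤ 1 := by
    rw [exp_le_one_iff]
    have : 0 ≤ √l * u := by positivity
    linarith
  unfold centerFoot
  exact div_nonneg (by linarith) (by positivity)

lemma one_sub_mul_centerFoot_sq {l : ℝ} (hl : 0 < l) (u : ℝ) :
    1 - l * centerFoot l u ^ 2 = 4 * exp (-(√l * u)) / (1 + exp (-(√l * u))) ^ 2 := by
  have hs : 0 < √l := sqrt_pos.2 hl
  have he := exp_pos (-(√l * u))
  have hl2 : l = √l ^ 2 := (sq_sqrt hl.le).symm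
  unfold centerFoot
  generalize exp (-(√l * u)) = e at *
  generalize √l = m at *
  subst hl2
  field_simp
  ring

lemma one_sub_mul_centerFoot_sq_pos {l : ℝ} (hl : 0 < l) (u : ℝ) :
    0 < 1 - l * centerFoot l u ^ 2 := by
  rw [one_sub_mul_centerFoot_sq hl]
  positivity

lemma hasDerivAt_centerFoot {l : ℝ} (hl : 0 < l) (u : ℝ) :
    HasDerivAt (centerFoot l) ((1 - l * centerFoot l u ^ 2) / 2) u := by
  rw [one_sub_mul_centerFoot_sq hl]
  have hs : 0 < √l := sqrt_pos.2 hl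
  have hp := exp_pos (-(√l * u))
  have he : HasDerivAt (fun u => exp (-(√l * u))) (exp (-(√l * u)) * (-(√l * 1))) u :=
    (((hasDerivAt_id u).const_mul (√l)).neg).exp
  have hne : √l * (1 + exp (-(√l * u))) ≠ 0 := by positivity
  refine ((he.const_sub 1).div ((he.const_add 1).const_mul (√l)) hne).congr_deriv ?_
  field_simp
  ring

lemma contDiff_centerFoot {l : ℝ} (hl : 0 < l) {n : WithTop ℕ∞} :
    ContDiff ℝ n (centerFoot l) := by
  have hs : 0 < √l := sqrt_pos.2 hl
  unfold centerFoot
  refine ContDiff.div (by fun_prop) (by fun_prop) (fun u => ?_)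
  have := exp_pos (-(√l * u))
  positivity

/-- In terms of `c = centerFoot l u`, the point at which the characteristic through `(u, r)`
meets `u = 0`. -/
noncomputable def charFoot (l c r : ℝ) : ℝ := (r + c) / (1 + l * r * c)

lemma charFoot_nonneg {l c r : ℝ} (hl : 0 < l) (hc : 0 ≤ c) (hr : 0 ≤ r) :
    0 ≤ charFoot l c r := by
  unfold charFoot
  positivity

lemma hasDerivAt_charFoot_right {l c r : ℝ} (hP : 1 + l * r * c ≠ 0) :
    HasDerivAt (charFoot l c) ((1 - l * c ^ 2) / (1 + l * r * c) ^ 2) r := by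
  have h1 : HasDerivAt (fun r => r + c) 1 r := (hasDerivAt_id r).add_const c
  have h2 : HasDerivAt (fun r => 1 + l * r * c) (l * 1 * c) r :=
    (((hasDerivAt_id r).const_mul l).mul_const c).const_add 1
  refine (h1.div h2 hP).congr_deriv ?_
  ring

lemma hasDerivAt_charFoot_left {l c r : ℝ} (hP : 1 + l * r * c ≠ 0) :
    HasDerivAt (fun c => charFoot l c r) ((1 - l * r ^ 2) / (1 + l * r * c) ^ 2) c := by
  have h1 : HasDerivAt (fun c => r + c) 1 c := (hasDerivAt_id c).const_add r
  have h2 : HasDerivAt (fun c => 1 + l * r * c) (l * r * 1) c :=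
    ((hasDerivAt_id c).const_mul (l * r)).const_add 1
  refine (h1.div h2 hP).congr_deriv ?_
  ring

/-- The explicit solution in terms of `c = centerFoot l u`, where `f`, `F`, `G` are the initial
datum, its primitive and the primitive of that. -/
noncomputable def solFormula (l : ℝ) (f F G : ℝ → ℝ) (c r : ℝ) : ℝ :=
  (1 - l * c ^ 2) / (1 + l * r * c) ^ 2 * f (charFoot l c r)
    + 2 * l * c * F (charFoot l c r) / (1 + l * r * c)
    + 2 * l * (l * c ^ 2 * G (charFoot l c r) - G c) / (1 - l * c ^ 2)

/-- The primitive in `r` of `solFormula` vanishing at `r = 0`. -/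
noncomputable def solPrimitive (l : ℝ) (F G : ℝ → ℝ) (c r : ℝ) : ℝ :=
  F (charFoot l c r) - F c
    + 2 * l * (c * (1 + l * r * c) * G (charFoot l c r) - (r + c) * G c) / (1 - l * c ^ 2)

lemma solPrimitive_zero (l : ℝ) (F G : ℝ → ℝ) (c : ℝ) : solPrimitive l F G c 0 = 0 := by
  simp [solPrimitive, charFoot]

section Formula

variable {l : ℝ} {f F G f' : ℝ → ℝ}

lemma hasDerivWithinAt_solPrimitive (hl : 0 < l)
    (hF : ∀ x, 0 ≤ x → HasDerivWithinAt F (f x) (Ici 0) x)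
    (hG : ∀ x, 0 ≤ x → HasDerivWithinAt G (F x) (Ici 0) x)
    {c r : ℝ} (hc : 0 ≤ c) (hQ : 0 < 1 - l * c ^ 2) (hr : 0 ≤ r) :
    HasDerivWithinAt (solPrimitive l F G c) (solFormula l f F G c r) (Ici 0) r := by
  have hP : 0 < 1 + l * r * c := by positivity
  have hρ0 := charFoot_nonneg hl hc hr
  have hρ := (hasDerivAt_charFoot_right (l := l) (c := c) hP.ne').hasDerivWithinAt (s := Ici 0)
  have hm : MapsTo (charFoot l c) (Ici 0) (Ici 0) := fun y hy => charFoot_nonneg hl hc hy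
  have hFρ := (hF _ hρ0).comp r hρ hm
  have hGρ := (hG _ hρ0).comp r hρ hm
  have h1 : HasDerivWithinAt (fun r => r + c) 1 (Ici 0) r :=
    ((hasDerivAt_id r).add_const c).hasDerivWithinAt
  have h2 : HasDerivWithinAt (fun r => 1 + l * r * c) (l * 1 * c) (Ici 0) r :=
    ((((hasDerivAt_id r).const_mul l).mul_const c).const_add 1).hasDerivWithinAt
  refine ((hFρ.sub_const (F c)).add
    (((((h2.const_mul c).mul hGρ).sub (h1.mul_const (G c))).const_mul (2 * l)).div_const
      (1 - l * c ^ 2))).congr_deriv ?_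
  simp only [Function.comp, solFormula]
  field_simp
  ring

lemma exists_hasDerivWithinAt_solFormula (hl : 0 < l)
    (hf : ∀ x, 0 ≤ x → HasDerivWithinAt f (f' x) (Ici 0) x)
    (hF : ∀ x, 0 ≤ x → HasDerivWithinAt F (f x) (Ici 0) x)
    (hG : ∀ x, 0 ≤ x → HasDerivWithinAt G (F x) (Ici 0) x)
    {c r : ℝ} (hc : 0 ≤ c) (hQ : 0 < 1 - l * c ^ 2) (hr : 0 ≤ r) :
    ∃ a b : ℝ,
      HasDerivWithinAt (fun c' => solFormula l f F G c' r) a (Ici 0) c ∧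
      HasDerivWithinAt (fun r' => solFormula l f F G c r') b (Ici 0) r ∧
      a * ((1 - l * c ^ 2) / 2) - (1/2) * (1 - l * r ^ 2) * b
        = -l * (r * solFormula l f F G c r - solPrimitive l F G c r) := by
  have hP : 0 < 1 + l * r * c := by positivity
  have hρ0 := charFoot_nonneg hl hc hr
  have hρr := (hasDerivAt_charFoot_right (l := l) (c := c) hP.ne').hasDerivWithinAt (s := Ici 0)
  have hmr : MapsTo (charFoot l c) (Ici 0) (Ici 0) := fun y hy => charFoot_nonneg hl hc hy
  have hρc := (hasDerivAt_charFoot_left (l := l) (r := r) hP.ne').hasDerivWithinAt (s := Ici 0)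
  have hmc : MapsTo (fun c => charFoot l c r) (Ici 0) (Ici 0) :=
    fun y hy => charFoot_nonneg hl hy hr
  have hPr : HasDerivWithinAt (fun r => 1 + l * r * c) (l * 1 * c) (Ici 0) r :=
    ((((hasDerivAt_id r).const_mul l).mul_const c).const_add 1).hasDerivWithinAt
  have hPc : HasDerivWithinAt (fun c => 1 + l * r * c) (l * r * 1) (Ici 0) c :=
    (((hasDerivAt_id c).const_mul (l * r)).const_add 1).hasDerivWithinAt
  have hid : HasDerivWithinAt (fun c : ℝ => c) 1 (Ici 0) c := hasDerivWithinAt_id c _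
  have hsq : HasDerivWithinAt (fun c : ℝ => l * c ^ 2) (l * (2 * c)) (Ici 0) c := by
    simpa using ((hasDerivAt_pow 2 c).const_mul l).hasDerivWithinAt
  have hQc := hsq.const_sub 1
  have hPr2 : HasDerivWithinAt (fun r => (1 + l * r * c) ^ 2)
      (2 * (1 + l * r * c) * (l * c)) (Ici 0) r := by
    refine (hPr.pow 2).congr_deriv ?_
    push_cast
    ring
  have hPc2 : HasDerivWithinAt (fun c => (1 + l * r * c) ^ 2)
      (2 * (1 + l * r * c) * (l * r)) (Ici 0) c := by
    refine (hPc.pow 2).congr_deriv ?_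
    push_cast
    ring
  have hP2 : (1 + l * r * c) ^ 2 ≠ 0 := by positivity
  have Dc := (((hQc.div hPc2 hP2).mul ((hf _ hρ0).comp c hρc hmc)).add
    (((hid.const_mul (2 * l)).mul ((hF _ hρ0).comp c hρc hmc)).div hPc hP.ne')).add
    ((((hsq.mul ((hG _ hρ0).comp c hρc hmc)).sub (hG c hc)).const_mul (2 * l)).div hQc hQ.ne')
  have Dr := ((((hasDerivWithinAt_const r (Ici 0) (1 - l * c ^ 2)).div hPr2 hP2).mul
      ((hf _ hρ0).comp r hρr hmr)).add
    ((((hF _ hρ0).comp r hρr hmr).const_mul (2 * l * c)).div hPr hP.ne')).add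
    ((((((hG _ hρ0).comp r hρr hmr).const_mul (l * c ^ 2)).sub_const (G c)).const_mul
      (2 * l)).div_const (1 - l * c ^ 2))
  refine ⟨_, _, Dc, Dr, ?_⟩
  simp only [Function.comp, solFormula, solPrimitive, Pi.sub_apply, Pi.mul_apply, Pi.div_apply]
  generalize f (charFoot l c r) = x1
  generalize f' (charFoot l c r) = x2
  generalize F (charFoot l c r) = x3
  generalize G (charFoot l c r) = x4
  generalize F c = x5
  generalize G c = x6
  field_simp
  ring

lemma continuousOn_solFormula_right (hl : 0 < l) (hf : ContinuousOn f (Ici 0))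
    (hF : ContinuousOn F (Ici 0)) (hG : ContinuousOn G (Ici 0)) {c : ℝ} (hc : 0 ≤ c) :
    ContinuousOn (solFormula l f F G c) (Ici 0) := by
  have hP : ∀ r ∈ Ici (0:ℝ), 1 + l * r * c ≠ 0 := fun r hr => by
    have : (0:ℝ) ≤ r := hr
    positivity
  have hρ : ContinuousOn (charFoot l c) (Ici 0) := fun r hr =>
    (hasDerivAt_charFoot_right (hP r hr)).continuousAt.continuousWithinAt
  have hm : MapsTo (charFoot l c) (Ici 0) (Ici 0) := fun y hy => charFoot_nonneg hl hc hy
  have hfρ := hf.comp hρ hm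
  have hFρ := hF.comp hρ hm
  have hGρ := hG.comp hρ hm
  refine ((ContinuousOn.mul (ContinuousOn.div (by fun_prop) (by fun_prop)
    (fun r hr => pow_ne_zero 2 (hP r hr))) hfρ).add
    (ContinuousOn.div (continuousOn_const.mul hFρ) (by fun_prop) hP)).add
    (ContinuousOn.div_const (continuousOn_const.mul
      ((continuousOn_const.mul hGρ).sub continuousOn_const)) _)

lemma integral_solFormula (hl : 0 < l) (hf : ContinuousOn f (Ici 0))
    (hF : ∀ x, 0 ≤ x → HasDerivWithinAt F (f x) (Ici 0) x)
    (hG : ∀ x, 0 ≤ x → HasDerivWithinAt G (F x) (Ici 0) x)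
    {c r : ℝ} (hc : 0 ≤ c) (hQ : 0 < 1 - l * c ^ 2) (hr : 0 ≤ r) :
    ∫ s in (0:ℝ)..r, solFormula l f F G c s = solPrimitive l F G c r := by
  have hd := fun x (hx : 0 ≤ x) => hasDerivWithinAt_solPrimitive hl hF hG hc hQ hx
  rw [intervalIntegral.integral_eq_sub_of_hasDeriv_right_of_le hr
    (f := solPrimitive l F G c), solPrimitive_zero, sub_zero]
  · exact fun x hx => (hd x hx.1).continuousWithinAt.mono Icc_subset_Ici_self
  · exact fun x hx => (hd x hx.1.le).mono (fun y hy => hx.1.le.trans (le_of_lt hy))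
  · apply ContinuousOn.intervalIntegrable
    rw [uIcc_of_le hr]
    exact (continuousOn_solFormula_right hl hf (fun x hx => (hF x hx).continuousWithinAt)
      (fun x hx => (hG x hx).continuousWithinAt) hc).mono Icc_subset_Ici_self

lemma contDiffOn_solFormula_centerFoot (hl : 0 < l) {k : ℕ} (hf : ContDiffOn ℝ k f (Ici 0))
    (hF : ContDiffOn ℝ k F (Ici 0)) (hG : ContDiffOn ℝ k G (Ici 0)) :
    ContDiffOn ℝ k (fun p : ℝ × ℝ => solFormula l f F G (centerFoot l p.1) p.2)
      (Ici 0 ×ˢ Ici 0) := by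
  set S : Set (ℝ × ℝ) := Ici 0 ×ˢ Ici 0
  have hc : ContDiffOn ℝ k (fun p : ℝ × ℝ => centerFoot l p.1) S :=
    ((contDiff_centerFoot hl).comp contDiff_fst).contDiffOn
  have hc0 : MapsTo (fun p : ℝ × ℝ => centerFoot l p.1) S (Ici 0) :=
    fun p hp => centerFoot_nonneg hp.1
  have hr : ContDiffOn ℝ k (fun p : ℝ × ℝ => p.2) S := contDiff_snd.contDiffOn
  have hP : ContDiffOn ℝ k (fun p : ℝ × ℝ => 1 + l * p.2 * centerFoot l p.1) S :=
    contDiffOn_const.add ((contDiffOn_const.mul hr).mul hc)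
  have hP0 : ∀ p ∈ S, 1 + l * p.2 * centerFoot l p.1 ≠ 0 := fun p hp => by
    have h1 : 0 ≤ p.2 := hp.2
    have h2 : 0 ≤ centerFoot l p.1 := hc0 hp
    positivity
  have hρ : ContDiffOn ℝ k (fun p : ℝ × ℝ => charFoot l (centerFoot l p.1) p.2) S :=
    (hr.add hc).div hP hP0
  have hm : MapsTo (fun p : ℝ × ℝ => charFoot l (centerFoot l p.1) p.2) S (Ici 0) :=
    fun p hp => charFoot_nonneg hl (hc0 hp) hp.2
  have hsq : ContDiffOn ℝ k (fun p : ℝ × ℝ => l * centerFoot l p.1 ^ 2) S :=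
    contDiffOn_const.mul (hc.pow 2)
  have hQ : ContDiffOn ℝ k (fun p : ℝ × ℝ => 1 - l * centerFoot l p.1 ^ 2) S :=
    contDiffOn_const.sub hsq
  exact (((hQ.div (hP.pow 2) (fun p hp => pow_ne_zero 2 (hP0 p hp))).mul (hf.comp hρ hm)).add
    (((contDiffOn_const.mul hc).mul (hF.comp hρ hm)).div hP hP0)).add
    ((contDiffOn_const.mul ((hsq.mul (hG.comp hρ hm)).sub (hG.comp hc hc0))).div hQ
      (fun p _ => (one_sub_mul_centerFoot_sq_pos hl p.1).ne'))

lemma hasPartialsSolving_solFormula {Λ : ℝ} (hΛ : 0 < Λ)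
    (hf : ∀ x, 0 ≤ x → HasDerivWithinAt f (f' x) (Ici 0) x)
    (hF : ∀ x, 0 ≤ x → HasDerivWithinAt F (f x) (Ici 0) x)
    (hG : ∀ x, 0 ≤ x → HasDerivWithinAt G (F x) (Ici 0) x) :
    HasPartialsSolving Λ (fun u r => solFormula (Λ / 3) f F G (centerFoot (Λ / 3) u) r) := by
  intro u r hu hr
  have hl : 0 < Λ / 3 := by positivity
  have hc := centerFoot_nonneg (l := Λ / 3) hu
  have hQ := one_sub_mul_centerFoot_sq_pos hl u
  obtain ⟨a, b, ha, hb, hab⟩ := exists_hasDerivWithinAt_solFormula hl hf hF hG hc hQ hr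
  refine ⟨_, b, ha.comp u (hasDerivAt_centerFoot hl u).hasDerivWithinAt
    (fun x hx => centerFoot_nonneg hx), hb, ?_⟩
  rw [integral_solFormula hl (fun x hx => (hf x hx).continuousWithinAt) hF hG hc hQ hr]
  exact hab

end Formula

/-- For `Λ > 0` and `h₀ ∈ C^k([0,∞))`, `k ≥ 1`, the characteristic
initial value problem `Dh = -(Λ/3) r (h - h̄)`, `h(0,·) = h₀`, has a unique solution
`h ∈ C^k([0,∞) × [0,∞))`. -/
theorem wave_dS_existence_uniqueness
    (Λ : ℝ) (hΛ : 0 < Λ) (k : ℕ) (hk : 1 ≤ k)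
    (h₀ : ℝ → ℝ) (h₀reg : ContDiffOn ℝ k h₀ (Set.Ici 0)) :
    ∃ h : ℝ → ℝ → ℝ,
      (ContDiffOn ℝ k (fun p : ℝ × ℝ => h p.1 p.2) (Set.Ici 0 ×ˢ Set.Ici 0) ∧
        IsSol Λ h ∧ ∀ r, 0 ≤ r → h 0 r = h₀ r) ∧
      ∀ h' : ℝ → ℝ → ℝ,
        (ContDiffOn ℝ k (fun p : ℝ × ℝ => h' p.1 p.2) (Set.Ici 0 ×ˢ Set.Ici 0) ∧
          IsSol Λ h' ∧ ∀ r, 0 ≤ r → h' 0 r = h₀ r) →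
        ∀ u r, 0 ≤ u → 0 ≤ r → h' u r = h u r := by
  set F : ℝ → ℝ := fun y => ∫ s in (0:ℝ)..y, h₀ s
  set G : ℝ → ℝ := fun y => ∫ s in (0:ℝ)..y, F s with hGdef
  have hk0 : (k : WithTop ℕ∞) ≠ 0 := by exact_mod_cast (by omega : k ≠ 0)
  have hl : 0 < Λ / 3 := by positivity
  have hFreg : ContDiffOn ℝ k F (Ici 0) := contDiffOn_integral_Ici h₀reg
  have hGreg : ContDiffOn ℝ k G (Ici 0) := contDiffOn_integral_Ici hFreg
  have hreg := contDiffOn_solFormula_centerFoot hl h₀reg hFreg hGreg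
  have hsol : HasPartialsSolving Λ
      (fun u r => solFormula (Λ / 3) h₀ F G (centerFoot (Λ / 3) u) r) :=
    hasPartialsSolving_solFormula hΛ
      (fun x hx => ((h₀reg.differentiableOn hk0) x hx).hasDerivWithinAt)
      (fun x hx => hasDerivWithinAt_integral_Ici h₀reg.continuousOn hx)
      (fun x hx => hasDerivWithinAt_integral_Ici hFreg.continuousOn hx)
  have hinit : ∀ r, solFormula (Λ / 3) h₀ F G (centerFoot (Λ / 3) 0) r = h₀ r := by
    intro r
    simp [solFormula, charFoot, centerFoot_zero, hGdef]
  refine ⟨_, ⟨hreg, hsol.isSol, fun r _ => hinit r⟩, ?_⟩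
  rintro h' ⟨hreg', hsol', hinit'⟩ u r hu hr
  exact (hsol'.hasPartialsSolving (hreg'.differentiableOn hk0)).unique hΛ hsol
    hreg'.continuousOn hreg.continuousOn (fun r hr => (hinit' r hr).trans (hinit r).symm) hu hr
end

section
/- Let Λ > 0, let h₀ ∈ C¹([0,∞)) with ‖h₀‖_{C⁰} := sup_{r≥0} |h₀(r)| finite, and let h be the solution of the characteristic problem Dh = −(Λ/3) r (h − h̄), h(0,r) = h₀(r). Then sup_{(u,r)∈[0,∞)×[0,∞)} |h(u,r)| = sup_{r≥0} |h₀(r)|. -/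
open Real Set

/-- First-order condition at a maximum over a real interval. -/
theorem IsMaxOn.sub_mul_derivWithin_nonpos {f : ℝ → ℝ} {f' x y a b : ℝ}
    (hmax : IsMaxOn f (Icc a b) x) (hf : HasDerivWithinAt f f' (Icc a b) x)
    (hx : x ∈ Icc a b) (hy : y ∈ Icc a b) : (y - x) * f' ≤ 0 := by
  have := (hmax.localize).hasFDerivWithinAt_nonpos hf.hasFDerivWithinAt
    (sub_mem_posTangentConeAt_of_segment_subset ((convex_Icc a b).segment_subset hx hy))
  simpa using this

/-- The mean over `[0,r]` does not exceed the value at `r` when the latter is maximal. -/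
theorem hbar_le_of_forall_le {h : ℝ → ℝ → ℝ} {u r : ℝ} (hr : 0 ≤ r)
    (hc : ContinuousOn (h u) (Ici 0)) (hle : ∀ s ∈ Icc 0 r, h u s ≤ h u r) :
    hbar h u r ≤ h u r := by
  unfold hbar
  split_ifs with h0
  · rw [h0]
  · have hpos : 0 < r := lt_of_le_of_ne hr (Ne.symm h0)
    rw [div_le_iff₀ hpos]
    have hint : IntervalIntegrable (h u) MeasureTheory.volume 0 r := by
      apply ContinuousOn.intervalIntegrable
      rw [uIcc_of_le hr]
      exact hc.mono Icc_subset_Ici_self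
    have := intervalIntegral.integral_mono_on hr hint intervalIntegrable_const hle
    simpa [mul_comm] using this

theorem IsSol.neg {Λ : ℝ} {h : ℝ → ℝ → ℝ} (hsol : IsSol Λ h) :
    IsSol Λ (fun u r => -h u r) := by
  intro u r hu hr
  have key := hsol u r hu hr
  have e : hbar (fun u r => -h u r) u r = -hbar h u r := by
    unfold hbar
    split_ifs
    · rfl
    · rw [intervalIntegral.integral_neg, neg_div]
  unfold pderivU pderivR at *
  rw [e, derivWithin.fun_neg, derivWithin.fun_neg]
  linarith

/-- Maximum principle: a solution is bounded above by any upper bound of its initial data. -/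
theorem IsSol.le_of_initial_le {Λ : ℝ} (hΛ : 0 < Λ) {h : ℝ → ℝ → ℝ} {M : ℝ}
    (hreg : ContDiffOn ℝ 1 (fun p : ℝ × ℝ => h p.1 p.2) (Ici 0 ×ˢ Ici 0))
    (hsol : IsSol Λ h) (hM : ∀ r, 0 ≤ r → h 0 r ≤ M) {u r : ℝ} (hu : 0 ≤ u) (hr : 0 ≤ r) :
    h u r ≤ M := by
  obtain ⟨R, hrR, hR⟩ : ∃ R, r ≤ R ∧ 1 ≤ Λ / 3 * R ^ 2 := by
    refine ⟨r + 1 + 3 / Λ, by linarith [div_pos three_pos hΛ], ?_⟩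
    have h3 : 0 < 3 / Λ := by positivity
    have h1 : Λ / 3 * (3 / Λ) = 1 := by field_simp
    have h2 : 3 / Λ ≤ (r + 1 + 3 / Λ) ^ 2 := by nlinarith
    calc (1 : ℝ) = Λ / 3 * (3 / Λ) := h1.symm
      _ ≤ _ := by gcongr
  have hR0 : 0 ≤ R := hr.trans hrR
  suffices H : ∀ ε > 0, h u r ≤ M + ε * u by
    refine le_of_forall_pos_le_add fun δ hδ => ?_
    have := H (δ / (u + 1)) (by positivity)
    have h2 : δ / (u + 1) * u ≤ δ := by
      rw [div_mul_eq_mul_div, div_le_iff₀ (by positivity)]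
      nlinarith
    linarith
  intro ε hε
  have hcont : ContinuousOn (fun p : ℝ × ℝ => h p.1 p.2 - ε * p.1) (Icc 0 u ×ˢ Icc 0 R) :=
    (hreg.continuousOn.mono (prod_mono Icc_subset_Ici_self Icc_subset_Ici_self)).sub
      (by fun_prop)
  obtain ⟨⟨v, s⟩, ⟨hv, hs⟩, hmax⟩ := (isCompact_Icc.prod isCompact_Icc).exists_isMaxOn
    ⟨(u, r), ⟨hu, le_rfl⟩, hr, hrR⟩ hcont
  have hmax' : ∀ v' ∈ Icc 0 u, ∀ s' ∈ Icc 0 R, h v' s' - ε * v' ≤ h v s - ε * v :=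
    fun v' hv' s' hs' => hmax (show (v', s') ∈ _ from ⟨hv', hs'⟩)
  dsimp only at hv hs
  have hur := hmax' u ⟨hu, le_rfl⟩ r ⟨hr, hrR⟩
  rcases hv.1.eq_or_lt with rfl | hvpos
  · linarith [hM s hs.1]
  exfalso
  have hd : DifferentiableWithinAt ℝ (fun p : ℝ × ℝ => h p.1 p.2) (Ici 0 ×ˢ Ici 0) (v, s) :=
    hreg.differentiableOn one_ne_zero _ ⟨hv.1, hs.1⟩
  have hdU : DifferentiableWithinAt ℝ (fun v' => h v' s) (Ici 0) v :=
    hd.comp (f := fun v' : ℝ => (v', s)) v (by fun_prop) fun _ hx => ⟨hx, hs.1⟩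
  have hdR : DifferentiableWithinAt ℝ (fun s' => h v s') (Ici 0) s :=
    hd.comp (f := fun s' : ℝ => (v, s')) s (by fun_prop) fun _ hx => ⟨hv.1, hx⟩
  have hcR : ContinuousOn (h v) (Ici 0) :=
    hreg.continuousOn.comp (f := fun s' : ℝ => (v, s')) (by fun_prop) fun _ hx => ⟨hv.1, hx⟩
  have hDU : HasDerivWithinAt (fun v' => h v' s - ε * v') (pderivU h v s - ε) (Icc 0 u) v := by
    simpa [pderivU] using (hdU.hasDerivWithinAt.mono Icc_subset_Ici_self).fun_sub
      ((hasDerivWithinAt_id v (Icc 0 u)).const_mul ε)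
  have hDR : HasDerivWithinAt (fun s' => h v s') (pderivR h v s) (Icc 0 R) s :=
    hdR.hasDerivWithinAt.mono Icc_subset_Ici_self
  have hmaxR : ∀ s' ∈ Icc 0 R, h v s' ≤ h v s := fun s' hs' => by
    linarith [hmax' v hv s' hs']
  have hU := IsMaxOn.sub_mul_derivWithin_nonpos (fun v' hv' => hmax' v' hv' s hs) hDU hv
    (left_mem_Icc.2 hu)
  have hR1 := IsMaxOn.sub_mul_derivWithin_nonpos hmaxR hDR hs (left_mem_Icc.2 hR0)
  have hR2 := IsMaxOn.sub_mul_derivWithin_nonpos hmaxR hDR hs (right_mem_Icc.2 hR0)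
  have hUε : ε ≤ pderivU h v s := by
    by_contra! hlt
    nlinarith
  have htransport : (1/2) * (1 - Λ/3 * s^2) * pderivR h v s ≤ 0 := by
    rcases hs.1.eq_or_lt with rfl | hs0
    · have hRpos : 0 < R := hR0.lt_of_ne (by rintro rfl; norm_num at hR)
      have ha : pderivR h v 0 ≤ 0 := by
        by_contra! hlt
        nlinarith
      linarith
    · have ha : 0 ≤ pderivR h v s := by
        by_contra! hlt
        nlinarith
      rcases hs.2.eq_or_lt with rfl | hsR
      · nlinarith
      · have : pderivR h v s = 0 := by
          apply le_antisymm _ ha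
          by_contra! hlt
          nlinarith
        simp [this]
  have hbar_le := hbar_le_of_forall_le hs.1 hcR fun s' hs' => hmaxR s' ⟨hs'.1, hs'.2.trans hs.2⟩
  have hrhs : 0 ≤ Λ/3 * s * (h v s - hbar h v s) :=
    mul_nonneg (mul_nonneg (by positivity) hs.1) (sub_nonneg.2 hbar_le)
  linarith [hsol v s hv.1 hs.1]

/-- If `h₀ ∈ C¹([0,∞))` has finite sup norm and `h` solves the
characteristic problem, then `sup |h| = sup |h₀|`: the supremum of `|h₀|` over `[0,∞)`
is the least upper bound of `|h|` over `[0,∞) × [0,∞)`. -/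
theorem wave_dS_sup_norm_eq
    (Λ : ℝ) (hΛ : 0 < Λ)
    (h₀ : ℝ → ℝ) (h₀reg : ContDiffOn ℝ 1 h₀ (Set.Ici 0))
    (h₀bdd : BddAbove ((fun r => |h₀ r|) '' Set.Ici 0))
    (h : ℝ → ℝ → ℝ)
    (hreg : ContDiffOn ℝ 1 (fun p : ℝ × ℝ => h p.1 p.2) (Set.Ici 0 ×ˢ Set.Ici 0))
    (hsol : IsSol Λ h) (hinit : ∀ r, 0 ≤ r → h 0 r = h₀ r) :
    IsLUB ((fun p : ℝ × ℝ => |h p.1 p.2|) '' (Set.Ici 0 ×ˢ Set.Ici 0))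
      (sSup ((fun r => |h₀ r|) '' Set.Ici 0)) := by
  have hle : ∀ r, 0 ≤ r → |h₀ r| ≤ sSup ((fun r => |h₀ r|) '' Set.Ici 0) := fun r hr =>
    le_csSup h₀bdd ⟨r, hr, rfl⟩
  constructor
  · rintro _ ⟨⟨u, r⟩, ⟨hu, hr⟩, rfl⟩
    refine abs_le'.2 ⟨?_, ?_⟩
    · exact hsol.le_of_initial_le hΛ hreg
        (fun r hr => by rw [hinit r hr]; exact (le_abs_self _).trans (hle r hr)) hu hr
    · exact hsol.neg.le_of_initial_le hΛ hreg.neg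
        (fun r hr => by rw [hinit r hr]; exact (neg_le_abs _).trans (hle r hr)) hu hr
  · intro b hb
    refine csSup_le (nonempty_Ici.image _) ?_
    rintro _ ⟨r, hr, rfl⟩
    exact hb ⟨(0, r), ⟨self_mem_Ici, hr⟩, by simp only [hinit r hr]⟩
end

section
/- Let Λ > 0, let h₀ ∈ C¹([0,∞)) be such that sup_{r≥0} (1+r)^p |h₀'(r)| < ∞ for some 0 ≤ p ≤ 4, let 0 < H ≤ 2√(Λ/3), and let h be the C¹ solution of the characteristic problem Dh = −(Λ/3) r (h − h̄), h(0,r) = h₀(r). Then there is a constant C, depending only on Λ and p, such that (1+r)^p e^{Hu} |∂h/∂r (u,r)| ≤ C · sup_{r≥0} (1+r)^p |h₀'(r)| for all (u,r) ∈ [0,∞)×[0,∞). -/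
open Real Set

open MeasureTheory Filter Topology

/-- Denominator of the characteristic flow (a Möbius map in the radius), where `x = √(Λ/3)` and
`s` is the rescaled time elapsed backwards along the characteristic. -/
noncomputable def charDen (x s r : ℝ) : ℝ := cosh s + x * r * sinh s

/-- The backward characteristic flow of the transport operator. -/
noncomputable def charRad (x s r : ℝ) : ℝ := (r * cosh s + sinh s / x) / charDen x s r

lemma one_le_charDen {x s r : ℝ} (hx : 0 < x) (hs : 0 ≤ s) (hr : 0 ≤ r) :
    1 ≤ charDen x s r := by
  have h1 := one_le_cosh s
  have h2 : 0 ≤ x * r * sinh s := by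
    have := sinh_nonneg_iff.2 hs
    positivity
  unfold charDen
  linarith

lemma charRad_pos {x s r : ℝ} (hx : 0 < x) (hs : 0 ≤ s) (hr : 0 < r) : 0 < charRad x s r := by
  have h1 := one_le_charDen hx hs hr.le
  have h2 := sinh_nonneg_iff.2 hs
  have h3 := cosh_pos s
  unfold charRad
  positivity

@[simp] lemma charDen_zero (x r : ℝ) : charDen x 0 r = 1 := by simp [charDen]

@[simp] lemma charRad_zero (x r : ℝ) : charRad x 0 r = r := by simp [charRad]

lemma hasDerivAt_charDen_time {x s r : ℝ} (hx : x ≠ 0) (hB : charDen x s r ≠ 0) :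
    HasDerivAt (fun s => charDen x s r) (x * charRad x s r * charDen x s r) s := by
  have h := (hasDerivAt_cosh s).add ((hasDerivAt_sinh s).const_mul (x * r))
  refine h.congr_deriv ?_
  unfold charRad
  field_simp
  ring

lemma hasDerivAt_charRad_time {x s r : ℝ} (hx : x ≠ 0) (hB : charDen x s r ≠ 0) :
    HasDerivAt (fun s => charRad x s r) ((1 - x ^ 2 * charRad x s r ^ 2) / x) s := by
  have h1 := ((hasDerivAt_cosh s).const_mul r).add ((hasDerivAt_sinh s).div_const x)
  refine (h1.div (hasDerivAt_charDen_time hx hB) hB).congr_deriv ?_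
  simp only [Pi.add_apply]
  unfold charRad
  field_simp
  unfold charDen
  ring

lemma hasDerivAt_charRad_radius {x s r : ℝ} (hx : x ≠ 0) (hB : charDen x s r ≠ 0) :
    HasDerivAt (fun r => charRad x s r) (1 / charDen x s r ^ 2) r := by
  have h1 := ((hasDerivAt_id r).mul_const (cosh s)).add_const (sinh s / x)
  have h2 : HasDerivAt (fun r => charDen x s r) (x * sinh s) r := by
    have := (((hasDerivAt_id r).const_mul x).mul_const (sinh s)).const_add (cosh s)
    simpa [charDen] using this
  refine (h1.div h2 hB).congr_deriv ?_
  have h3 := cosh_sq s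
  simp only [id]
  field_simp
  unfold charDen
  linear_combination h3

/-- Pointwise bound behind the decay estimate. -/
lemma weight_bound {x s r p : ℝ} (hx : 0 < x) (hs : 0 ≤ s) (hr : 0 ≤ r) (hp0 : 0 ≤ p)
    (hp4 : p ≤ 4) :
    (1 + r) ^ p * exp s ^ 4 ≤ 16 * (1 + charRad x s r) ^ p * charDen x s r ^ 4 := by
  have hB := one_le_charDen hx hs hr
  have hS := sinh_nonneg_iff.2 hs
  have hC : exp s / 2 ≤ cosh s := by
    rw [cosh_eq]; have := exp_pos (-s); linarith
  have hR : 0 ≤ charRad x s r := by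
    have := cosh_pos s
    unfold charRad; positivity
  have hE := exp_pos s
  set q := 2 * charDen x s r / exp s with hq
  have hq1 : 1 ≤ q := by
    rw [hq, le_div_iff₀ hE]
    have : 0 ≤ x * r * sinh s := by positivity
    unfold charDen; linarith
  have h1 : 1 + r ≤ (1 + charRad x s r) * q := by
    have e : (1 + charRad x s r) * q
        = 2 * (charDen x s r + (r * cosh s + sinh s / x)) / exp s := by
      rw [hq]; unfold charRad; field_simp
    rw [e, le_div_iff₀ hE]
    have h2 : 0 ≤ sinh s / x := by positivity
    have h3 : 0 ≤ x * r * sinh s := by positivity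
    have h4 := mul_le_mul_of_nonneg_left hC hr
    unfold charDen
    linarith
  have h2 : (1 + r) ^ p ≤ (1 + charRad x s r) ^ p * q ^ (4 : ℕ) := by
    calc (1 + r) ^ p ≤ ((1 + charRad x s r) * q) ^ p :=
          rpow_le_rpow (by positivity) h1 hp0
      _ = (1 + charRad x s r) ^ p * q ^ p := mul_rpow (by positivity) (by positivity)
      _ ≤ (1 + charRad x s r) ^ p * q ^ (4 : ℝ) := by
          gcongr
      _ = _ := by norm_cast
  calc (1 + r) ^ p * exp s ^ 4 ≤ (1 + charRad x s r) ^ p * q ^ (4 : ℕ) * exp s ^ 4 := by gcongr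
    _ = _ := by rw [hq]; field_simp; norm_num

/-- Differentiation under the integral sign for integrands continuous on a rectangle. -/
lemma hasDerivAt_integral_of_continuousOn_rect {F F' : ℝ → ℝ → ℝ} {a b c d x₀ : ℝ} (hab : a ≤ b)
    (hx₀ : x₀ ∈ Ioo c d) (hF : ∀ x ∈ Icc c d, ContinuousOn (F x) (Icc a b))
    (hF' : ContinuousOn (fun q : ℝ × ℝ => F' q.1 q.2) (Icc c d ×ˢ Icc a b))
    (hd : ∀ x ∈ Icc c d, ∀ t ∈ Icc a b, HasDerivAt (fun x => F x t) (F' x t) x) :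
    HasDerivAt (fun x => ∫ t in a..b, F x t) (∫ t in a..b, F' x₀ t) x₀ := by
  obtain ⟨M, hM⟩ := (isCompact_Icc.prod isCompact_Icc).exists_bound_of_continuousOn hF'
  have hsub : uIoc a b ⊆ Icc a b := by rw [uIoc_of_le hab]; exact Ioc_subset_Icc_self
  have hmem : Icc c d ∈ 𝓝 x₀ := Icc_mem_nhds hx₀.1 hx₀.2
  have hx₀' : x₀ ∈ Icc c d := Ioo_subset_Icc_self hx₀
  have hF'x : ContinuousOn (F' x₀) (Icc a b) :=
    hF'.comp (f := fun t => (x₀, t)) (by fun_prop) fun t ht => ⟨hx₀', ht⟩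
  refine (intervalIntegral.hasDerivAt_integral_of_dominated_loc_of_deriv_le
    (bound := fun _ => M) hmem ?_ ?_ ?_ ?_ ?_ ?_).2
  · filter_upwards [hmem] with x hx
    exact ((hF x hx).mono hsub).aestronglyMeasurable measurableSet_uIoc
  · exact ContinuousOn.intervalIntegrable (by rw [uIcc_of_le hab]; exact hF x₀ hx₀')
  · exact (hF'x.mono hsub).aestronglyMeasurable measurableSet_uIoc
  · exact Eventually.of_forall fun t ht x hx => hM (x, t) ⟨hx, hsub ht⟩
  · exact intervalIntegrable_const
  · exact Eventually.of_forall fun t ht x hx => hd x hx t (hsub ht)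

/-- If `f` satisfies along characteristics the integrated equation whose formal radial derivative
is `Dw = -2 x² r w`, where `w` is the radial derivative of `f`, then `w` is given by the
representation formula. -/
lemma radial_deriv_representation {x : ℝ} (hx : 0 < x) {f : ℝ → ℝ → ℝ} {w : ℝ × ℝ → ℝ}
    (hw : Continuous w)
    (hf : ∀ v r, 0 ≤ v → 0 < r → HasDerivAt (f v) (w (v, r)) r) {T : ℝ} (hT : 0 ≤ T)
    (hint : ∀ r, 0 < r → ∀ v ∈ Icc 0 T, f v (charRad x (x / 2 * (T - v)) r)
      = f 0 (charRad x (x / 2 * T) r)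
        + ∫ t in (0:ℝ)..v, -x ^ 2 * ∫ y in (0:ℝ)..charRad x (x / 2 * (T - t)) r, y * w (t, y))
    {r : ℝ} (hr : 0 < r) :
    w (T, r) * charDen x (x / 2 * T) r ^ 4 = w (0, charRad x (x / 2 * T) r) := by
  have hs : ∀ {v}, v ∈ Icc 0 T → 0 ≤ x / 2 * (T - v) := fun hv =>
    mul_nonneg (by positivity) (by linarith [hv.2])
  have hB : ∀ {v}, v ∈ Icc 0 T → ∀ {r}, 0 < r → charDen x (x / 2 * (T - v)) r ≠ 0 :=
    fun hv _ hr => (zero_lt_one.trans_le (one_le_charDen hx (hs hv) hr.le)).ne'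
  have hBcont : Continuous fun q : ℝ × ℝ => charDen x (x / 2 * (T - q.2)) q.1 := by
    unfold charDen
    fun_prop
  have hRcont : ContinuousOn (fun q : ℝ × ℝ => charRad x (x / 2 * (T - q.2)) q.1)
      (Ioi 0 ×ˢ Icc 0 T) := by
    unfold charRad
    refine ContinuousOn.div (by fun_prop) hBcont.continuousOn fun q hq => hB hq.2 hq.1
  have hslice : ∀ {r : ℝ}, 0 < r → ContinuousOn (fun t => (r, t)) (Icc 0 T) ∧
      MapsTo (fun t => (r, t)) (Icc 0 T) (Ioi 0 ×ˢ Icc 0 T) := fun hr =>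
    ⟨by fun_prop, fun t ht => ⟨hr, ht⟩⟩
  set g' : ℝ → ℝ → ℝ := fun r t =>
    -x ^ 2 * (charRad x (x / 2 * (T - t)) r * w (t, charRad x (x / 2 * (T - t)) r)
      * (1 / charDen x (x / 2 * (T - t)) r ^ 2)) with hg'
  have hg'cont : ContinuousOn (fun q : ℝ × ℝ => g' q.1 q.2) (Ioi 0 ×ˢ Icc 0 T) := by
    refine continuousOn_const.mul ((hRcont.mul
      (hw.comp_continuousOn (continuousOn_snd.prodMk hRcont))).mul
      (continuousOn_const.div (hBcont.pow 2).continuousOn fun q hq => pow_ne_zero 2 (hB hq.2 hq.1)))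
  have hg'r : ContinuousOn (g' r) (Icc 0 T) :=
    hg'cont.comp (hslice hr).1 (hslice hr).2
  have hRd : ∀ {v}, v ∈ Icc 0 T → ∀ {r}, 0 < r → HasDerivAt
      (fun r => charRad x (x / 2 * (T - v)) r) (1 / charDen x (x / 2 * (T - v)) r ^ 2) r :=
    fun hv _ hr => hasDerivAt_charRad_radius hx.ne' (hB hv hr)
  have hfd : ∀ v ∈ Icc 0 T, HasDerivAt (fun r => f v (charRad x (x / 2 * (T - v)) r))
      (w (v, charRad x (x / 2 * (T - v)) r) * (1 / charDen x (x / 2 * (T - v)) r ^ 2)) r :=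
    fun v hv => (hf v _ hv.1 (charRad_pos hx (hs hv) hr)).comp r (hRd hv hr)
  have h0 : (0:ℝ) ∈ Icc 0 T := ⟨le_rfl, hT⟩
  have hTm : T ∈ Icc 0 T := ⟨hT, le_rfl⟩
  have key : ∀ v ∈ Icc 0 T,
      w (v, charRad x (x / 2 * (T - v)) r) * (1 / charDen x (x / 2 * (T - v)) r ^ 2)
        = w (0, charRad x (x / 2 * (T - 0)) r) * (1 / charDen x (x / 2 * (T - 0)) r ^ 2)
          + ∫ t in (0:ℝ)..v, g' r t := by
    intro v hv
    have hsub : Icc 0 v ⊆ Icc 0 T := Icc_subset_Icc_right hv.2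
    have hpos : ∀ {y}, y ∈ Icc (r / 2) (2 * r) → 0 < y := fun hy => by linarith [hy.1]
    have hyw : Continuous (Function.uncurry fun t y : ℝ => y * w (t, y)) := by
      simp only [Function.uncurry_def]
      fun_prop
    have hI := hasDerivAt_integral_of_continuousOn_rect (F := fun r t =>
      -x ^ 2 * ∫ y in (0:ℝ)..charRad x (x / 2 * (T - t)) r, y * w (t, y)) (F' := g')
      (c := r / 2) (d := 2 * r) (x₀ := r) hv.1 ⟨by linarith, by linarith⟩
      (fun y hy => continuousOn_const.mul
        ((intervalIntegral.continuous_parametric_primitive_of_continuous hyw).comp_continuousOn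
          (continuousOn_id.prodMk
            ((hRcont.comp (hslice (hpos hy)).1 (hslice (hpos hy)).2).mono hsub))))
      (hg'cont.mono (prod_mono (fun y hy => hpos hy) hsub))
      (fun y hy t ht => by
        have hc : Continuous fun y => y * w (t, y) := by fun_prop
        exact (((hc.integral_hasStrictDerivAt 0 _).hasDerivAt.comp y
          (hRd (hsub ht) (hpos hy))).const_mul (-x ^ 2)))
    refine (hfd v hv).unique (((hfd 0 h0).add hI).congr_of_eventuallyEq ?_)
    filter_upwards [lt_mem_nhds hr] with y hy
    simpa using hint y hy v hv
  -- `Z` divided by the squared denominator is constant in time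
  set Z : ℝ → ℝ := fun v =>
    w (0, charRad x (x / 2 * (T - 0)) r) * (1 / charDen x (x / 2 * (T - 0)) r ^ 2)
      + ∫ t in (0:ℝ)..v, g' r t with hZ
  have hBd : ∀ v ∈ Icc 0 T, HasDerivAt (fun v => charDen x (x / 2 * (T - v)) r)
      (x * charRad x (x / 2 * (T - v)) r * charDen x (x / 2 * (T - v)) r * (-(x / 2))) v := by
    intro v hv
    have h1 : HasDerivAt (fun v => x / 2 * (T - v)) (-(x / 2)) v := by
      simpa using ((hasDerivAt_id v).const_sub T).const_mul (x / 2)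
    exact (hasDerivAt_charDen_time hx.ne' (hB hv hr)).comp v h1
  have hBc : ContinuousOn (fun v => charDen x (x / 2 * (T - v)) r) (Icc 0 T) :=
    fun v hv => (hBd v hv).continuousAt.continuousWithinAt
  have hconst := constant_of_has_deriv_right_zero (a := 0) (b := T)
    (f := fun v => Z v / charDen x (x / 2 * (T - v)) r ^ 2) ?_ ?_ T hTm
  · simp only [← key T hTm, hZ] at hconst
    have hB0 := hB h0 hr
    simp only [sub_self, mul_zero, charRad_zero, charDen_zero, sub_zero,
      intervalIntegral.integral_same, add_zero] at hconst hB0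
    rw [one_pow, div_one, div_one, mul_one, mul_one_div, div_div, ← pow_add] at hconst
    exact (eq_div_iff (pow_ne_zero _ hB0)).1 hconst
  · refine ContinuousOn.div ?_ (hBc.pow 2) fun v hv => pow_ne_zero 2 (hB hv hr)
    refine continuousOn_const.add ?_
    have := intervalIntegral.continuousOn_primitive_interval (μ := volume) (f := g' r) (a := 0) (b := T)
      (by rw [uIcc_of_le hT]; exact hg'r.integrableOn_Icc)
    rwa [uIcc_of_le hT] at this
  · intro v hv
    have hv' : v ∈ Icc 0 T := Ico_subset_Icc_self hv
    have hnb : Icc 0 T ∈ 𝓝[>] v :=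
      mem_of_superset (Ioo_mem_nhdsGT hv.2) fun t ht => ⟨hv.1.trans ht.1.le, ht.2.le⟩
    have hZd : HasDerivWithinAt Z (g' r v) (Ici v) v := by
      refine HasDerivWithinAt.const_add _ ?_
      refine intervalIntegral.integral_hasDerivWithinAt_right (t := Ioi v) ?_ ?_ ?_
      · refine (hg'r.mono ?_).intervalIntegrable
        rw [uIcc_of_le hv.1]
        exact Icc_subset_Icc_right hv.2.le
      · exact ⟨Icc 0 T, hnb, hg'r.aestronglyMeasurable measurableSet_Icc⟩
      · exact (hg'r v hv').mono_of_mem_nhdsWithin hnb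
    refine (hZd.div ((hBd v hv').pow 2).hasDerivWithinAt (pow_ne_zero 2 (hB hv' hr))).congr_deriv ?_
    have hZv : Z v = _ := (key v hv').symm
    simp only [hZv, hg', Pi.pow_apply]
    have := hB hv' hr
    field_simp
    ring

section Regularity

variable {h : ℝ → ℝ → ℝ}

/-- The closed quadrant. -/
abbrev closedQuadrant : Set (ℝ × ℝ) := Ici 0 ×ˢ Ici 0

lemma hasFDerivWithinAt_quadrant
    (hC : ContDiffOn ℝ 1 (fun q : ℝ × ℝ => h q.1 q.2) closedQuadrant) {q : ℝ × ℝ}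
    (hq : q ∈ closedQuadrant) :
    HasFDerivWithinAt (fun q : ℝ × ℝ => h q.1 q.2)
      (fderivWithin ℝ (fun q : ℝ × ℝ => h q.1 q.2) closedQuadrant q) closedQuadrant q :=
  ((hC.differentiableOn (by norm_num)) q hq).hasFDerivWithinAt

lemma hasDerivWithinAt_pderivR (hC : ContDiffOn ℝ 1 (fun q : ℝ × ℝ => h q.1 q.2) closedQuadrant)
    {u r : ℝ} (hu : 0 ≤ u) (hr : 0 ≤ r) :
    HasDerivWithinAt (h u) (pderivR h u r) (Ici 0) r ∧
      pderivR h u r = fderivWithin ℝ (fun q : ℝ × ℝ => h q.1 q.2) closedQuadrant (u, r) (0, 1) := by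
  have h1 : HasDerivWithinAt (fun r' : ℝ => (u, r')) ((0:ℝ), (1:ℝ)) (Ici 0) r :=
    (hasDerivWithinAt_const r _ u).prodMk (hasDerivWithinAt_id r _)
  have h2 := (hasFDerivWithinAt_quadrant hC (q := (u, r)) ⟨hu, hr⟩).comp_hasDerivWithinAt r h1
    fun r' hr' => ⟨hu, hr'⟩
  have h3 : pderivR h u r = _ := h2.derivWithin (uniqueDiffOn_Ici 0 r hr)
  exact ⟨h2.congr_deriv h3.symm, h3⟩

lemma pderivU_eq_fderivWithin (hC : ContDiffOn ℝ 1 (fun q : ℝ × ℝ => h q.1 q.2) closedQuadrant)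
    {u r : ℝ} (hu : 0 ≤ u) (hr : 0 ≤ r) :
    pderivU h u r = fderivWithin ℝ (fun q : ℝ × ℝ => h q.1 q.2) closedQuadrant (u, r) (1, 0) := by
  have h1 : HasDerivWithinAt (fun u' : ℝ => (u', r)) ((1:ℝ), (0:ℝ)) (Ici 0) u :=
    (hasDerivWithinAt_id u _).prodMk (hasDerivWithinAt_const u _ r)
  have h2 := (hasFDerivWithinAt_quadrant hC (q := (u, r)) ⟨hu, hr⟩).comp_hasDerivWithinAt u h1
    fun u' hu' => mk_mem_prod hu' (mem_Ici.2 hr)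
  exact h2.derivWithin (uniqueDiffOn_Ici 0 u hu)

/-- The radial derivative, extended continuously from the quadrant to the plane. -/
lemma continuous_pderivR_extend (hC : ContDiffOn ℝ 1 (fun q : ℝ × ℝ => h q.1 q.2) closedQuadrant) :
    Continuous fun q : ℝ × ℝ => pderivR h (max q.1 0) (max q.2 0) := by
  have hm : ∀ q : ℝ × ℝ, (max q.1 0, max q.2 0) ∈ closedQuadrant :=
    fun q => ⟨mem_Ici.2 (le_max_right _ _), mem_Ici.2 (le_max_right _ _)⟩
  have h1 := hC.continuousOn_fderivWithin
    ((uniqueDiffOn_Ici (0:ℝ)).prod (uniqueDiffOn_Ici (0:ℝ))) le_rfl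
  have h2 : Continuous fun q : ℝ × ℝ =>
      fderivWithin ℝ (fun q : ℝ × ℝ => h q.1 q.2) closedQuadrant (max q.1 0, max q.2 0) :=
    h1.comp_continuous (by fun_prop) hm
  refine (h2.clm_apply (continuous_const (y := ((0:ℝ), (1:ℝ))))).congr fun q => ?_
  exact (hasDerivWithinAt_pderivR hC (hm q).1 (hm q).2).2.symm

lemma mul_sub_hbar_eq_integral (hC : ContDiffOn ℝ 1 (fun q : ℝ × ℝ => h q.1 q.2) closedQuadrant)
    {u r : ℝ} (hu : 0 ≤ u) (hr : 0 ≤ r) :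
    r * (h u r - hbar h u r) = ∫ y in (0:ℝ)..r, y * pderivR h (max u 0) (max y 0) := by
  have hcont : ContinuousOn (h u) (Ici 0) := fun y hy =>
    (hasDerivWithinAt_pderivR hC hu hy).1.continuousWithinAt
  have hIcc : Icc 0 r ⊆ Ici 0 := Icc_subset_Ici_self
  have hprim := intervalIntegral.continuousOn_primitive_interval (μ := volume) (f := h u)
    (a := 0) (b := r) (by rw [uIcc_of_le hr]; exact (hcont.mono hIcc).integrableOn_Icc)
  rw [uIcc_of_le hr] at hprim
  have hw := continuous_pderivR_extend hC
  have key := intervalIntegral.integral_eq_sub_of_hasDerivAt_of_le hr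
    (f := fun y => y * h u y - ∫ s in (0:ℝ)..y, h u s)
    (f' := fun y => y * pderivR h (max u 0) (max y 0))
    ((continuousOn_id.mul (hcont.mono hIcc)).sub hprim) (fun y hy => ?_)
    (Continuous.intervalIntegrable (continuous_id.mul
      (hw.comp (continuous_const.prodMk continuous_id))) _ _)
  · rw [key]
    unfold hbar
    split_ifs with h0
    · simp [h0]
    · simp only [intervalIntegral.integral_same]
      field_simp
      ring
  · have hyn : Ici (0:ℝ) ∈ 𝓝 y := Ici_mem_nhds hy.1
    have hd : HasDerivAt (h u) (pderivR h u y) y :=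
      (hasDerivWithinAt_pderivR hC hu hy.1.le).1.hasDerivAt hyn
    have hi : HasDerivAt (fun y => ∫ s in (0:ℝ)..y, h u s) (h u y) y := by
      refine intervalIntegral.integral_hasDerivAt_right ?_ ?_ hd.continuousAt
      · refine (hcont.mono ?_).intervalIntegrable
        rw [uIcc_of_le hy.1.le]
        exact Icc_subset_Ici_self
      · exact ⟨Ici 0, hyn, hcont.aestronglyMeasurable measurableSet_Ici⟩
    refine (((hasDerivAt_id y).mul hd).sub hi).congr_deriv ?_
    rw [max_eq_left hu, max_eq_left hy.1.le]
    simp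

/-- The equation integrated along a backward characteristic. -/
lemma IsSol.integrated {Λ x : ℝ} (hx : 0 < x) (hΛ : Λ / 3 = x ^ 2)
    (hC : ContDiffOn ℝ 1 (fun q : ℝ × ℝ => h q.1 q.2) closedQuadrant) (hsol : IsSol Λ h)
    {T r : ℝ} (hr : 0 < r) {v : ℝ} (hv : v ∈ Icc 0 T) :
    h v (charRad x (x / 2 * (T - v)) r) = h 0 (charRad x (x / 2 * T) r)
      + ∫ t in (0:ℝ)..v, -x ^ 2 * ∫ y in (0:ℝ)..charRad x (x / 2 * (T - t)) r,
          y * pderivR h (max t 0) (max y 0) := by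
  have hs : ∀ {t}, t ∈ Icc 0 v → 0 ≤ x / 2 * (T - t) := fun ht =>
    mul_nonneg (by positivity) (by linarith [ht.2, hv.2])
  have hRd : ∀ {t}, t ∈ Icc 0 v → HasDerivAt (fun t => charRad x (x / 2 * (T - t)) r)
      (-(1 / 2) * (1 - x ^ 2 * charRad x (x / 2 * (T - t)) r ^ 2)) t := by
    intro t ht
    have h1 : HasDerivAt (fun v => x / 2 * (T - v)) (-(x / 2)) t := by
      simpa using ((hasDerivAt_id t).const_sub T).const_mul (x / 2)
    have hB := (zero_lt_one.trans_le (one_le_charDen hx (hs ht) hr.le)).ne'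
    refine ((hasDerivAt_charRad_time hx.ne' hB).comp t h1).congr_deriv ?_
    field_simp
  have hRc : ContinuousOn (fun t => charRad x (x / 2 * (T - t)) r) (Icc 0 v) :=
    fun t ht => (hRd ht).continuousAt.continuousWithinAt
  have hmap : MapsTo (fun t => (t, charRad x (x / 2 * (T - t)) r)) (Icc 0 v) closedQuadrant :=
    fun t ht => ⟨ht.1, (charRad_pos hx (hs ht) hr).le⟩
  have hyw : Continuous (Function.uncurry fun t y : ℝ => y * pderivR h (max t 0) (max y 0)) :=
    continuous_snd.mul (continuous_pderivR_extend hC)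
  have key := intervalIntegral.integral_eq_sub_of_hasDerivAt_of_le hv.1
    (f := fun t => h t (charRad x (x / 2 * (T - t)) r))
    (f' := fun t => -x ^ 2 * ∫ y in (0:ℝ)..charRad x (x / 2 * (T - t)) r,
          y * pderivR h (max t 0) (max y 0))
    (hC.continuousOn.comp (continuousOn_id.prodMk hRc) hmap) (fun t ht => ?_) ?_
  · rw [key, sub_zero]
    ring
  · have ht' : t ∈ Icc 0 v := Ioo_subset_Icc_self ht
    have hq := hmap ht'
    have h1 := (hasFDerivWithinAt_quadrant hC hq).comp_hasDerivWithinAt t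
      ((hasDerivWithinAt_id t (Icc 0 v)).prodMk (hRd ht').hasDerivWithinAt) hmap
    refine (h1.hasDerivAt (Icc_mem_nhds ht.1 ht.2)).congr_deriv ?_
    have hsplit : ∀ c : ℝ, ((1:ℝ), c) = ((1:ℝ), (0:ℝ)) + c • ((0:ℝ), (1:ℝ)) := by simp
    rw [hsplit, map_add, map_smul, ← pderivU_eq_fderivWithin hC hq.1 hq.2,
      ← (hasDerivWithinAt_pderivR hC hq.1 hq.2).2, ← mul_sub_hbar_eq_integral hC hq.1 hq.2,
      smul_eq_mul]
    have := hsol _ _ hq.1 hq.2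
    rw [hΛ] at this
    simp only at this ⊢
    linear_combination this
  · refine ContinuousOn.intervalIntegrable ?_
    rw [uIcc_of_le hv.1]
    exact continuousOn_const.mul
      ((intervalIntegral.continuous_parametric_primitive_of_continuous hyw).comp_continuousOn
        (continuousOn_id.prodMk hRc))

end Regularity

/-- Weighted exponential decay estimate for `∂_r h`: there is a
constant `C`, depending only on `Λ` and `p`, such that whenever `h₀ ∈ C¹([0,∞))`
satisfies `(1+r)^p |h₀'(r)| ≤ d₀`, `0 < H ≤ 2√(Λ/3)`, and `h` is the `C¹` solution of
the characteristic problem, then `(1+r)^p e^{Hu} |∂_r h(u,r)| ≤ C d₀`. -/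
theorem wave_dS_derivative_decay
    (Λ : ℝ) (hΛ : 0 < Λ) (p : ℝ) (hp0 : 0 ≤ p) (hp4 : p ≤ 4) :
    ∃ C : ℝ, 0 < C ∧
      ∀ (h₀ : ℝ → ℝ) (h : ℝ → ℝ → ℝ) (H d₀ : ℝ),
        ContDiffOn ℝ 1 h₀ (Set.Ici 0) →
        (∀ r, 0 ≤ r → (1 + r) ^ p * |derivWithin h₀ (Set.Ici 0) r| ≤ d₀) →
        0 < H → H ≤ 2 * Real.sqrt (Λ / 3) →
        ContDiffOn ℝ 1 (fun q : ℝ × ℝ => h q.1 q.2) (Set.Ici 0 ×ˢ Set.Ici 0) →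
        IsSol Λ h →
        (∀ r, 0 ≤ r → h 0 r = h₀ r) →
        ∀ u r, 0 ≤ u → 0 ≤ r →
          (1 + r) ^ p * Real.exp (H * u) * |pderivR h u r| ≤ C * d₀ := by
  refine ⟨16, by norm_num, fun h₀ h H d₀ _ hd₀ _ hH hC hsol hinit => ?_⟩
  set x := Real.sqrt (Λ / 3)
  have hx : 0 < x := Real.sqrt_pos.2 (by positivity)
  have hΛx : Λ / 3 = x ^ 2 := (Real.sq_sqrt (by positivity)).symm
  have hw := continuous_pderivR_extend hC
  have hinit' : ∀ r, 0 ≤ r → pderivR h 0 r = derivWithin h₀ (Ici 0) r := fun r hr =>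
    derivWithin_congr (fun y hy => hinit y hy) (hinit r hr)
  have hpos : ∀ u r, 0 ≤ u → 0 < r →
      (1 + r) ^ p * Real.exp (H * u) * |pderivR h u r| ≤ 16 * d₀ := by
    intro u r hu hr
    have hs : 0 ≤ x / 2 * u := by positivity
    have hR := charRad_pos hx hs hr
    have hB := one_le_charDen hx hs hr.le
    have hrep := radial_deriv_representation hx (f := h) hw
      (fun v r hv hr => by
        simp only [max_eq_left hv, max_eq_left hr.le]
        exact (hasDerivWithinAt_pderivR hC hv hr.le).1.hasDerivAt (Ici_mem_nhds hr))
      hu (fun r hr v hv => hsol.integrated hx hΛx hC hr hv) hr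
    simp only [max_eq_left hu, max_eq_left hr.le, max_self, max_eq_left hR.le,
      hinit' _ hR.le] at hrep
    have hexp : exp (H * u) ≤ exp (x / 2 * u) ^ 4 := by
      rw [← exp_nat_mul]
      refine exp_le_exp.2 ?_
      push_cast
      nlinarith [mul_le_mul_of_nonneg_right hH hu]
    have hbound := weight_bound hx hs hr.le hp0 hp4
    calc (1 + r) ^ p * exp (H * u) * |pderivR h u r|
        ≤ (1 + r) ^ p * exp (x / 2 * u) ^ 4 * |pderivR h u r| := by gcongr
      _ ≤ 16 * (1 + charRad x (x / 2 * u) r) ^ p * charDen x (x / 2 * u) r ^ 4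
            * |pderivR h u r| := by gcongr
      _ = 16 * ((1 + charRad x (x / 2 * u) r) ^ p
            * |derivWithin h₀ (Ici 0) (charRad x (x / 2 * u) r)|) := by
          rw [← hrep, abs_mul, abs_of_nonneg (a := charDen x (x / 2 * u) r ^ 4) (by positivity)]
          ring
      _ ≤ 16 * d₀ := by
          gcongr
          exact hd₀ _ hR.le
  intro u r hu hr
  obtain hr | rfl := hr.lt_or_eq
  · exact hpos u r hu hr
  · have hcont : Continuous fun r : ℝ =>
        (1 + max r 0) ^ p * exp (H * u) * |pderivR h (max u 0) (max r 0)| := by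
      refine Continuous.mul (Continuous.mul ?_ continuous_const)
        (hw.comp (continuous_const.prodMk continuous_id)).abs
      exact Continuous.rpow_const (by fun_prop) fun _ => Or.inr hp0
    have hlim := (hcont.tendsto 0).mono_left (nhdsWithin_le_nhds (s := Ioi 0))
    have := le_of_tendsto hlim (b := 16 * d₀) (by
      filter_upwards [self_mem_nhdsWithin] with y hy
      rw [max_eq_left hu, max_eq_left (le_of_lt hy)]
      exact hpos u y hu hy)
    simpa only [max_self, max_eq_left hu] using this
end

section
/- Let Λ > 0, let h₀ ∈ C¹([0,∞)) with sup_{r≥0} |h₀(r)| < ∞ and sup_{r≥0} (1+r)^p |h₀'(r)| < ∞ for some 0 ≤ p ≤ 4, let 0 < H ≤ 2√(Λ/3), and let h be the C¹ solution of the characteristic problem Dh = −(Λ/3) r (h − h̄), h(0,r) = h₀(r). Then there exist a real constant h̲ and a constant C > 0 such that |h(u,r) − h̲| ≤ C (1+r)^{n(p)} e^{−Hu} for all (u,r) ∈ [0,∞)×[0,∞), where n(p) = 0 if 2 < p ≤ 4 and n(p) = 2 if 0 ≤ p ≤ 2. -/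
open Real Set

/-- The exponent `n(p)`: `0` for `2 < p ≤ 4` and `2` for `0 ≤ p ≤ 2`. -/
noncomputable def nExp (p : ℝ) : ℝ := if 2 < p then 0 else 2

/-- The label at `u = 0` of the characteristic through `(u, r)`, where `E = exp (-k u)`. -/
noncomputable def charLabel (k E r : ℝ) : ℝ :=
  ((1 + k * r) - E * (1 - k * r)) / (k * ((1 + k * r) + E * (1 - k * r)))

/-- `g` solves the wave equation with `k² = Λ / 3`, and `v`, `w` are continuous extensions of its
partial derivatives in `u` and `r` from the quadrant to the plane. -/
structure IsExtendedSol (k : ℝ) (g v w : ℝ → ℝ → ℝ) : Prop where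
  cont_g : Continuous (fun q : ℝ × ℝ => g q.1 q.2)
  cont_v : Continuous (fun q : ℝ × ℝ => v q.1 q.2)
  cont_w : Continuous (fun q : ℝ × ℝ => w q.1 q.2)
  deriv_u : ∀ u r, 0 < u → 0 ≤ r → HasDerivAt (fun u' => g u' r) (v u r) u
  deriv_r : ∀ u r, 0 ≤ u → 0 < r → HasDerivAt (fun r' => g u r') (w u r) r
  eqn : ∀ u r, 0 ≤ u → 0 ≤ r →
    v u r - (1/2) * (1 - k^2 * r^2) * w u r = -k^2 * (r * g u r - ∫ s in (0:ℝ)..r, g u s)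

/-- A first integral of the equation along characteristics. -/
noncomputable def charInvariant (k : ℝ) (g : ℝ → ℝ → ℝ) (u r : ℝ) : ℝ :=
  (1 - k^2 * r^2) * g u r + 2 * k^2 * ∫ s in (0:ℝ)..r, s * g u s

lemma charLabel_denom_pos {k E r : ℝ} (hk : 0 < k) (hE0 : 0 < E) (hE1 : E ≤ 1) (hr : 0 ≤ r) :
    1 ≤ (1 + k * r) + E * (1 - k * r) := by
  nlinarith [mul_nonneg hk.le hr, mul_nonneg (mul_nonneg hk.le hr) (sub_nonneg.2 hE1)]

lemma charLabel_pos {k E r : ℝ} (hk : 0 < k) (hE0 : 0 < E) (hE1 : E ≤ 1) (hr : 0 < r) :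
    0 < charLabel k E r := by
  have hD := charLabel_denom_pos hk hE0 hE1 hr.le
  unfold charLabel
  apply div_pos
  · nlinarith [mul_pos hk hr, mul_pos hE0 (mul_pos hk hr)]
  · exact mul_pos hk (by linarith)

lemma charLabel_nonneg {k E r : ℝ} (hk : 0 < k) (hE0 : 0 < E) (hE1 : E ≤ 1) (hr : 0 ≤ r) :
    0 ≤ charLabel k E r := by
  have hD := charLabel_denom_pos hk hE0 hE1 hr
  unfold charLabel
  apply div_nonneg
  · nlinarith [mul_nonneg hk.le hr, mul_nonneg hE0.le (mul_nonneg hk.le hr)]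
  · exact (mul_pos hk (by linarith)).le

lemma charLabel_one {k r : ℝ} (hk : 0 < k) : charLabel k 1 r = r := by
  unfold charLabel
  have : (1 + k * r) + 1 * (1 - k * r) = 2 := by ring
  rw [this]
  field_simp
  ring

lemma one_sub_charLabel_sq {k E r : ℝ} (hk : 0 < k) (hE0 : 0 < E) (hE1 : E ≤ 1) (hr : 0 ≤ r) :
    1 - k^2 * charLabel k E r ^ 2
      = 4 * E * (1 - k^2 * r^2) / ((1 + k * r) + E * (1 - k * r))^2 := by
  have hD := charLabel_denom_pos hk hE0 hE1 hr
  have hD' : (1 + k * r) + E * (1 - k * r) ≠ 0 := by linarith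
  unfold charLabel
  field_simp
  ring

lemma hasDerivAt_charLabel {k E r : ℝ} (hk : 0 < k) (hE0 : 0 < E) (hE1 : E ≤ 1) (hr : 0 ≤ r) :
    HasDerivAt (charLabel k E) (4 * E / ((1 + k * r) + E * (1 - k * r))^2) r := by
  have hD := charLabel_denom_pos hk hE0 hE1 hr
  have hD' : (1 + k * r) + E * (1 - k * r) ≠ 0 := by linarith
  have h1 : HasDerivAt (fun r => 1 + k * r) k r := by
    simpa using ((hasDerivAt_id r).const_mul k).const_add 1
  have h2 : HasDerivAt (fun r => E * (1 - k * r)) (E * (-k)) r := by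
    simpa using (((hasDerivAt_id r).const_mul k).const_sub 1).const_mul E
  have := (h1.sub h2).div ((h1.add h2).const_mul k) (mul_ne_zero hk.ne' hD')
  refine this.congr_deriv ?_
  simp only [Pi.add_apply, Pi.sub_apply]
  field_simp
  ring

lemma exp_neg_mul_le_one {k : ℝ} (hk : 0 < k) {u : ℝ} (hu : 0 ≤ u) : exp (-k * u) ≤ 1 := by
  apply exp_le_one_iff.2
  nlinarith [mul_nonneg hk.le hu]

lemma hasDerivAt_charLabel_exp {k u r τ : ℝ} (hk : 0 < k) (hτ : τ ≤ u) (hr : 0 ≤ r) :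
    HasDerivAt (fun τ => charLabel k (exp (-k * (u - τ))) r)
      (-(1/2) * (1 - k^2 * charLabel k (exp (-k * (u - τ))) r ^ 2)) τ := by
  have hE1 : exp (-k * (u - τ)) ≤ 1 :=
    exp_neg_mul_le_one hk (sub_nonneg.2 hτ)
  have hE0 := exp_pos (-k * (u - τ))
  have hD := charLabel_denom_pos hk hE0 hE1 hr
  have hD' : (1 + k * r) + exp (-k * (u - τ)) * (1 - k * r) ≠ 0 := by linarith
  rw [one_sub_charLabel_sq hk hE0 hE1 hr]
  have hE : HasDerivAt (fun τ => exp (-k * (u - τ))) (exp (-k * (u - τ)) * k) τ := by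
    have : HasDerivAt (fun τ => -k * (u - τ)) k τ := by
      simpa using ((hasDerivAt_id τ).const_sub u).const_mul (-k)
    exact this.exp
  have h2 := hE.mul_const (1 - k * r)
  have := (h2.const_sub (1 + k * r)).div ((h2.const_add (1 + k * r)).const_mul k)
    (mul_ne_zero hk.ne' hD')
  refine this.congr_deriv ?_
  field_simp
  ring

/-- The weight picks up the growth of the label: `1 + r ≤ D (1 + charLabel)`. -/
lemma one_add_le_charLabel {k E r : ℝ} (hk : 0 < k) (hE0 : 0 < E) (hE1 : E ≤ 1) (hr : 0 ≤ r) :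
    1 + r ≤ ((1 + k * r) + E * (1 - k * r)) * (1 + charLabel k E r) := by
  have hD := charLabel_denom_pos hk hE0 hE1 hr
  have hD' : (1 + k * r) + E * (1 - k * r) ≠ 0 := by linarith
  have : ((1 + k * r) + E * (1 - k * r)) * (1 + charLabel k E r)
      = (1 + k * r) + E * (1 - k * r) + ((1 - E) / k + r * (1 + E)) := by
    unfold charLabel
    field_simp
    ring
  rw [this]
  have h1 : 0 ≤ (1 - E) / k := div_nonneg (by linarith) hk.le
  nlinarith [mul_nonneg hr hE0.le]

/-- A function whose derivative is dominated by that of `B` varies at most as much as `B`. -/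
lemma abs_sub_le_of_abs_deriv_le {f f' B B' : ℝ → ℝ} {a b : ℝ} (hab : a ≤ b)
    (hf : ContinuousOn f (Icc a b)) (hB : ContinuousOn B (Icc a b))
    (hf' : ∀ x ∈ Ioo a b, HasDerivAt f (f' x) x) (hB' : ∀ x ∈ Ioo a b, HasDerivAt B (B' x) x)
    (hle : ∀ x ∈ Ioo a b, |f' x| ≤ B' x) : |f b - f a| ≤ B b - B a := by
  have h1 : MonotoneOn (B - f) (Icc a b) := by
    refine monotoneOn_of_hasDerivWithinAt_nonneg (convex_Icc a b) (hB.sub hf)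
      (f' := fun x => B' x - f' x) ?_ ?_
    · intro x hx
      rw [interior_Icc] at hx
      exact ((hB' x hx).sub (hf' x hx)).hasDerivWithinAt
    · intro x hx
      rw [interior_Icc] at hx
      linarith [(abs_le.1 (hle x hx)).2]
  have h2 : MonotoneOn (B + f) (Icc a b) := by
    refine monotoneOn_of_hasDerivWithinAt_nonneg (convex_Icc a b) (hB.add hf)
      (f' := fun x => B' x + f' x) ?_ ?_
    · intro x hx
      rw [interior_Icc] at hx
      exact ((hB' x hx).add (hf' x hx)).hasDerivWithinAt
    · intro x hx
      rw [interior_Icc] at hx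
      linarith [(abs_le.1 (hle x hx)).1]
  have e1 := h1 (left_mem_Icc.2 hab) (right_mem_Icc.2 hab) hab
  have e2 := h2 (left_mem_Icc.2 hab) (right_mem_Icc.2 hab) hab
  simp only [Pi.add_apply, Pi.sub_apply] at e1 e2
  rw [abs_le]
  constructor <;> linarith

namespace IsExtendedSol

variable {k : ℝ} {g v w : ℝ → ℝ → ℝ}

lemma cont_g_r (S : IsExtendedSol k g v w) (u : ℝ) : Continuous (g u) :=
  S.cont_g.comp (Continuous.prodMk_right u)

lemma cont_v_r (S : IsExtendedSol k g v w) (u : ℝ) : Continuous (v u) :=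
  S.cont_v.comp (Continuous.prodMk_right u)

lemma cont_w_r (S : IsExtendedSol k g v w) (u : ℝ) : Continuous (w u) :=
  S.cont_w.comp (Continuous.prodMk_right u)

lemma cont_g_u (S : IsExtendedSol k g v w) (r : ℝ) : Continuous (fun u => g u r) :=
  S.cont_g.comp (Continuous.prodMk_left r)

lemma hasDerivAt_primitive (S : IsExtendedSol k g v w) (u r : ℝ) :
    HasDerivAt (fun r => ∫ s in (0:ℝ)..r, g u s) (g u r) r :=
  ((S.cont_g_r u).integral_hasStrictDerivAt 0 r).hasDerivAt

lemma integral_mul_v (S : IsExtendedSol k g v w) {u r : ℝ} (hu : 0 ≤ u) (hr : 0 ≤ r) :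
    ∫ s in (0:ℝ)..r, s * v u s
      = (1/2) * (1 - k^2 * r^2) * (r * g u r - ∫ s in (0:ℝ)..r, g u s) := by
  have key := intervalIntegral.integral_eq_sub_of_hasDerivAt_of_le (a := 0) (b := r)
    (f := fun r => (1/2) * (1 - k^2 * r^2) * (r * g u r - ∫ s in (0:ℝ)..r, g u s))
    (f' := fun s => s * v u s) hr ?_ ?_ ?_
  · rw [key]; simp
  · have h1 : Continuous (fun r => ∫ s in (0:ℝ)..r, g u s) :=
      continuous_iff_continuousAt.2 fun x => (S.hasDerivAt_primitive u x).continuousAt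
    have h2 := S.cont_g_r u
    exact Continuous.continuousOn (by fun_prop)
  · intro x hx
    have h1 := S.hasDerivAt_primitive u x
    have h2 := S.deriv_r u x hu hx.1
    have h3 : HasDerivAt (fun r : ℝ => (1/2) * (1 - k^2 * r^2)) (-(k^2 * x)) x := by
      have := ((((hasDerivAt_id x).pow 2).const_mul (k^2)).const_sub 1).const_mul (1/2)
      refine this.congr_deriv ?_
      simp
      ring
    have := h3.mul (((hasDerivAt_id x).mul h2).sub h1)
    refine this.congr_deriv ?_
    have e := S.eqn u x hu hx.1.le
    simp only [Pi.sub_apply, Pi.mul_apply, id]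
    linear_combination (-x) * e
  · exact (continuous_id.mul (S.cont_v_r u)).intervalIntegrable _ _

lemma hasDerivAt_integral_mul (S : IsExtendedSol k g v w) {u r : ℝ} (hu : 0 < u) (hr : 0 ≤ r) :
    HasDerivAt (fun u => ∫ s in (0:ℝ)..r, s * g u s) (∫ s in (0:ℝ)..r, s * v u s) u := by
  obtain ⟨C, hC⟩ := ((isCompact_Icc (a := u/2) (b := u+1)).prod
    (isCompact_Icc (a := (0:ℝ)) (b := r))).exists_bound_of_continuousOn
    (f := fun q : ℝ × ℝ => q.2 * v q.1 q.2) (continuous_snd.mul S.cont_v).continuousOn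
  refine (intervalIntegral.hasDerivAt_integral_of_dominated_loc_of_deriv_le
    (s := Icc (u/2) (u+1)) (bound := fun _ => C) (F' := fun u s => s * v u s)
    (Icc_mem_nhds (by linarith) (by linarith)) ?_ ?_ ?_ ?_ ?_ ?_).2
  · exact Filter.Eventually.of_forall fun x =>
      (continuous_id.mul (S.cont_g_r x)).aestronglyMeasurable
  · exact (continuous_id.mul (S.cont_g_r u)).intervalIntegrable _ _
  · exact (continuous_id.mul (S.cont_v_r u)).aestronglyMeasurable
  · refine Filter.Eventually.of_forall fun t ht x hx => ?_
    rw [uIoc_of_le hr] at ht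
    exact hC (x, t) ⟨hx, ht.1.le, ht.2⟩
  · exact intervalIntegrable_const
  · refine Filter.Eventually.of_forall fun t ht x hx => ?_
    rw [uIoc_of_le hr] at ht
    exact (S.deriv_u x t (by linarith [hx.1]) ht.1.le).const_mul t

lemma hasDerivAt_charInvariant_u (S : IsExtendedSol k g v w) {u r : ℝ} (hu : 0 < u)
    (hr : 0 ≤ r) :
    HasDerivAt (fun u => charInvariant k g u r) ((1/2) * (1 - k^2 * r^2)^2 * w u r) u := by
  have h1 := (S.deriv_u u r hu hr).const_mul (1 - k^2 * r^2)
  have h2 := (S.hasDerivAt_integral_mul hu hr).const_mul (2 * k^2)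
  refine (h1.add h2).congr_deriv ?_
  rw [S.integral_mul_v hu.le hr]
  have e := S.eqn u r hu.le hr
  linear_combination (1 - k^2 * r^2) * e

lemma hasDerivAt_charInvariant_r (S : IsExtendedSol k g v w) {u r : ℝ} (hu : 0 ≤ u)
    (hr : 0 < r) :
    HasDerivAt (fun r => charInvariant k g u r) ((1 - k^2 * r^2) * w u r) r := by
  have h3 : HasDerivAt (fun r : ℝ => (1 - k^2 * r^2)) (-(2 * k^2 * r)) r := by
    have := (((hasDerivAt_id r).pow 2).const_mul (k^2)).const_sub 1
    refine this.congr_deriv ?_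
    simp
    ring
  have h1 := h3.mul (S.deriv_r u r hu hr)
  have hsg : Continuous fun s => s * g u s := continuous_id.mul (S.cont_g_r u)
  have h2 := (hsg.integral_hasStrictDerivAt 0 r).hasDerivAt.const_mul (2 * k^2)
  refine (h1.add h2).congr_deriv ?_
  simp
  ring

lemma continuous_charInvariant (S : IsExtendedSol k g v w) :
    Continuous (fun q : ℝ × ℝ => charInvariant k g q.1 q.2) := by
  have h1 : Continuous (fun q : ℝ × ℝ => ∫ s in (0:ℝ)..q.2, s * g q.1 s) :=
    intervalIntegral.continuous_parametric_primitive_of_continuous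
      (f := fun u s => s * g u s) (continuous_snd.mul S.cont_g)
  have h2 := S.cont_g
  unfold charInvariant
  fun_prop

lemma hasStrictFDerivAt_charInvariant (S : IsExtendedSol k g v w) {u r : ℝ} (hu : 0 < u)
    (hr : 0 < r) :
    HasStrictFDerivAt (fun q : ℝ × ℝ => charInvariant k g q.1 q.2)
      ((ContinuousLinearMap.toSpanSingleton ℝ ((1/2) * (1 - k^2 * r^2)^2 * w u r)).coprod
        (ContinuousLinearMap.toSpanSingleton ℝ ((1 - k^2 * r^2) * w u r))) (u, r) := by
  have hnear : ∀ᶠ q : ℝ × ℝ in nhds (u, r), 0 < q.1 ∧ 0 < q.2 :=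
    ((isOpen_lt continuous_const continuous_fst).inter
      (isOpen_lt continuous_const continuous_snd)).mem_nhds ⟨hu, hr⟩
  have hw := S.cont_w
  have hc1 : Continuous fun q : ℝ × ℝ => (1/2) * (1 - k^2 * q.2^2)^2 * w q.1 q.2 := by fun_prop
  have hc2 : Continuous fun q : ℝ × ℝ => (1 - k^2 * q.2^2) * w q.1 q.2 := by fun_prop
  have hs : Continuous (ContinuousLinearMap.toSpanSingleton ℝ : ℝ → ℝ →L[ℝ] ℝ) :=
    (ContinuousLinearMap.toSpanSingletonCLE (𝕜 := ℝ) (E := ℝ)).continuous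
  exact hasStrictFDerivAt_uncurry_coprod (𝕜 := ℝ) (u := (u, r)) (f := charInvariant k g)
    (f₁ := fun a b => ContinuousLinearMap.toSpanSingleton ℝ ((1/2) * (1 - k^2 * b^2)^2 * w a b))
    (f₂ := fun a b => ContinuousLinearMap.toSpanSingleton ℝ ((1 - k^2 * b^2) * w a b))
    (hnear.mono fun q hq => (S.hasDerivAt_charInvariant_u hq.1 hq.2.le).hasFDerivAt)
    (hnear.mono fun q hq => (S.hasDerivAt_charInvariant_r hq.1.le hq.2).hasFDerivAt)
    (hs.comp hc1).continuousAt (hs.comp hc2).continuousAt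

lemma hasDerivAt_charInvariant_comp (S : IsExtendedSol k g v w) {c : ℝ → ℝ} {c' τ : ℝ}
    (hτ : 0 < τ) (hpos : 0 < c τ) (hc : HasDerivAt c c' τ) :
    HasDerivAt (fun τ => charInvariant k g τ (c τ))
      ((1 - k^2 * c τ ^ 2) * w τ (c τ) * ((1/2) * (1 - k^2 * c τ ^ 2) + c')) τ := by
  have := HasFDerivAt.comp_hasDerivAt (f := fun τ => (τ, c τ)) τ
    (S.hasStrictFDerivAt_charInvariant hτ hpos).hasFDerivAt ((hasDerivAt_id τ).prodMk hc)
  refine this.congr_deriv ?_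
  simp only [ContinuousLinearMap.coprod_apply, ContinuousLinearMap.toSpanSingleton_apply,
    smul_eq_mul]
  ring

lemma charInvariant_eq_of_isIntegralCurve (S : IsExtendedSol k g v w) {c : ℝ → ℝ} {u : ℝ}
    (hu : 0 ≤ u) (hpos : ∀ τ ∈ Icc 0 u, 0 < c τ)
    (hc : ∀ τ ∈ Icc 0 u, HasDerivAt c (-(1/2) * (1 - k^2 * c τ ^ 2)) τ) :
    charInvariant k g u (c u) = charInvariant k g 0 (c 0) := by
  have hcc : ContinuousOn c (Icc 0 u) := fun τ hτ => (hc τ hτ).continuousAt.continuousWithinAt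
  have hpair : ContinuousOn (fun τ : ℝ => (τ, c τ)) (Icc 0 u) := by fun_prop
  have hcont : ContinuousOn (fun τ => charInvariant k g τ (c τ)) (Icc 0 u) := by
    have hQ := S.continuous_charInvariant
    generalize charInvariant k g = Q at hQ ⊢
    exact hQ.comp_continuousOn hpair
  have hder : ∀ τ ∈ Ioo 0 u, HasDerivAt (fun τ => charInvariant k g τ (c τ)) 0 τ := by
    intro τ hτ
    have hτ' := Ioo_subset_Icc_self hτ
    refine (S.hasDerivAt_charInvariant_comp hτ.1 (hpos τ hτ') (hc τ hτ')).congr_deriv ?_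
    ring
  have h0 := abs_sub_le_of_abs_deriv_le (B := fun _ => 0) (B' := fun _ => 0) hu hcont
    continuousOn_const hder (fun x _ => hasDerivAt_const x 0) (fun x _ => abs_zero.le)
  rw [sub_self, abs_nonpos_iff] at h0
  linarith

lemma charInvariant_eq (S : IsExtendedSol k g v w) (hk : 0 < k) {u r : ℝ} (hu : 0 ≤ u)
    (hr : 0 < r) :
    charInvariant k g u r = charInvariant k g 0 (charLabel k (exp (-k * u)) r) := by
  have key := S.charInvariant_eq_of_isIntegralCurve
    (c := fun τ => charLabel k (exp (-k * (u - τ))) r) hu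
    (fun τ hτ => charLabel_pos hk (exp_pos _)
      (exp_neg_mul_le_one hk (sub_nonneg.2 hτ.2)) hr)
    (fun τ hτ => hasDerivAt_charLabel_exp hk hτ.2 hr.le)
  simpa only [sub_self, mul_zero, exp_zero, charLabel_one hk, sub_zero] using key

/-- The explicit formula for the radial derivative. -/
lemma w_formula (S : IsExtendedSol k g v w) (hk : 0 < k) {u r : ℝ} (hu : 0 ≤ u) (hr : 0 ≤ r) :
    w u r = (4 * exp (-k * u) / ((1 + k * r) + exp (-k * u) * (1 - k * r))^2)^2
      * w 0 (charLabel k (exp (-k * u)) r) := by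
  set E := exp (-k * u) with hE
  have hE0 : 0 < E := exp_pos _
  have hE1 : E ≤ 1 := exp_neg_mul_le_one hk hu
  have main : ∀ x, 0 < x → k * x ≠ 1 →
      w u x = (4 * E / ((1 + k * x) + E * (1 - k * x))^2)^2 * w 0 (charLabel k E x) := by
    intro x hx hx1
    have hD := charLabel_denom_pos hk hE0 hE1 hx.le
    have h1 := S.hasDerivAt_charInvariant_r hu hx
    have h2 := (S.hasDerivAt_charInvariant_r le_rfl (charLabel_pos hk hE0 hE1 hx)).comp x
      (hasDerivAt_charLabel hk hE0 hE1 hx.le)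
    have h3 := h1.unique (h2.congr_of_eventuallyEq (by
      filter_upwards [lt_mem_nhds hx] with y hy
      exact S.charInvariant_eq hk hu hy))
    rw [one_sub_charLabel_sq hk hE0 hE1 hx.le] at h3
    have hne : 1 - k^2 * x^2 ≠ 0 := by
      have : 1 - k^2 * x^2 = (1 - k * x) * (1 + k * x) := by ring
      rw [this]
      exact mul_ne_zero (sub_ne_zero.2 hx1.symm) (by positivity)
    apply mul_left_cancel₀ hne
    rw [h3]
    ring
  have hD := charLabel_denom_pos hk hE0 hE1 hr
  have hc1 : ContinuousAt (w u) r := (S.cont_w_r u).continuousAt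
  have hc2 : ContinuousAt
      (fun x => (4 * E / ((1 + k * x) + E * (1 - k * x))^2)^2 * w 0 (charLabel k E x)) r := by
    refine ContinuousAt.mul (ContinuousAt.pow (ContinuousAt.div ?_ ?_ ?_) 2) ?_
    · fun_prop
    · fun_prop
    · positivity
    · exact (S.cont_w_r 0).continuousAt.comp (hasDerivAt_charLabel hk hE0 hE1 hr).continuousAt
  have hev : ∀ᶠ x in nhdsWithin r (Ioi r), 0 < x ∧ k * x ≠ 1 := by
    rcases lt_or_ge (k * r) 1 with h | h
    · have : r < 1 / k := by rw [lt_div_iff₀ hk]; linarith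
      filter_upwards [Ioo_mem_nhdsGT this] with x hx
      refine ⟨lt_of_le_of_lt hr hx.1, ne_of_lt ?_⟩
      have := hx.2
      rw [lt_div_iff₀ hk] at this
      linarith
    · filter_upwards [self_mem_nhdsWithin] with x hx
      have hx' : r < x := hx
      refine ⟨lt_of_le_of_lt hr hx, ne_of_gt ?_⟩
      nlinarith
  exact tendsto_nhds_unique (hc1.tendsto.mono_left nhdsWithin_le_nhds)
    ((hc2.tendsto.mono_left nhdsWithin_le_nhds).congr'
      (hev.mono fun x hx => (main x hx.1 hx.2).symm))

lemma abs_w_le (S : IsExtendedSol k g v w) (hk : 0 < k) {M : ℝ}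
    (h0 : ∀ r, 0 ≤ r → |w 0 r| ≤ M) {u r : ℝ} (hu : 0 ≤ u) (hr : 0 ≤ r) :
    |w u r| ≤ 16 * M * exp (-k * u)^2 := by
  have hE0 : 0 < exp (-k * u) := exp_pos _
  have hE1 := exp_neg_mul_le_one hk hu
  rw [S.w_formula hk hu hr]
  have hD := charLabel_denom_pos hk hE0 hE1 hr
  have hl := charLabel_nonneg hk hE0 hE1 hr
  generalize charLabel k (exp (-k * u)) r = ρ at *
  generalize (1 + k * r) + exp (-k * u) * (1 - k * r) = D at *
  generalize exp (-k * u) = E at *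
  have hq : 4 * E / D^2 ≤ 4 * E := div_le_self (by positivity) (one_le_pow₀ hD)
  have hq0 : 0 ≤ 4 * E / D^2 := by positivity
  rw [abs_mul, abs_of_nonneg (sq_nonneg _)]
  calc (4 * E / D^2)^2 * |w 0 ρ| ≤ (4 * E)^2 * M := by
        gcongr
        exact h0 ρ hl
    _ = 16 * M * E^2 := by ring

lemma abs_w_le_weighted (S : IsExtendedSol k g v w) (hk : 0 < k) {M : ℝ}
    (h0 : ∀ r, 0 ≤ r → (1 + r)^2 * |w 0 r| ≤ M) {u r : ℝ} (hu : 0 ≤ u) (hr : 0 ≤ r) :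
    |w u r| ≤ 16 * M * exp (-k * u)^2 / (1 + r)^2 := by
  have hE0 : 0 < exp (-k * u) := exp_pos _
  have hE1 := exp_neg_mul_le_one hk hu
  rw [S.w_formula hk hu hr]
  have hD := charLabel_denom_pos hk hE0 hE1 hr
  have hl := charLabel_nonneg hk hE0 hE1 hr
  have hlin := one_add_le_charLabel hk hE0 hE1 hr
  generalize charLabel k (exp (-k * u)) r = ρ at *
  generalize (1 + k * r) + exp (-k * u) * (1 - k * r) = D at *
  generalize exp (-k * u) = E at *
  have hDpos : 0 < D := by linarith
  rw [le_div_iff₀ (by positivity), abs_mul, abs_of_nonneg (sq_nonneg _)]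
  calc (4 * E / D^2)^2 * |w 0 ρ| * (1 + r)^2
      ≤ (4 * E / D^2)^2 * |w 0 ρ| * (D * (1 + ρ))^2 := by gcongr
    _ = (4 * E / D)^2 * ((1 + ρ)^2 * |w 0 ρ|) := by field_simp
    _ ≤ (4 * E)^2 * M := by
        have : 4 * E / D ≤ 4 * E := div_le_self (by positivity) hD
        gcongr
        exact h0 ρ hl
    _ = 16 * M * E^2 := by ring

/-- Decay along the axis `r = 0` to a limiting constant. -/
lemma exists_limit_axis (S : IsExtendedSol k g v w) (hk : 0 < k) {M : ℝ} (hM : 0 ≤ M)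
    (h0 : ∀ r, 0 ≤ r → |w 0 r| ≤ M) :
    ∃ L : ℝ, ∀ u, 0 ≤ u → |g u 0 - L| ≤ 4 * M / k * exp (-k * u)^2 := by
  have hE2 : ∀ u : ℝ, HasDerivAt (fun u => exp (-k * u)^2) (-(2 * k * exp (-k * u)^2)) u := by
    intro u
    have h1 : HasDerivAt (fun u => -k * u) (-k) u := by
      simpa using (hasDerivAt_id u).const_mul (-k)
    refine (h1.exp.pow 2).congr_deriv ?_
    simp
    ring
  have key : ∀ a b, 0 ≤ a → a ≤ b → |g b 0 - g a 0| ≤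
      4 * M / k * exp (-k * a)^2 - 4 * M / k * exp (-k * b)^2 := by
    intro a b ha hab
    have hB : ∀ x : ℝ, HasDerivAt (fun u => -(4 * M / k * exp (-k * u)^2))
        (8 * M * exp (-k * x)^2) x := by
      intro x
      refine ((hE2 x).const_mul (4 * M / k)).neg.congr_deriv ?_
      field_simp
      ring
    have := abs_sub_le_of_abs_deriv_le (f := fun u => g u 0) (f' := fun u => v u 0) hab
      (S.cont_g_u 0).continuousOn (fun x _ => (hB x).continuousAt.continuousWithinAt)
      (fun x hx => S.deriv_u x 0 (lt_of_le_of_lt ha hx.1) le_rfl) (fun x _ => hB x) ?_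
    · linarith
    · intro x hx
      have hx0 : 0 ≤ x := ha.trans hx.1.le
      have e := S.eqn x 0 hx0 le_rfl
      have hv : v x 0 = (1/2) * w x 0 := by
        simp at e
        linarith
      have := S.abs_w_le hk h0 hx0 le_rfl
      rw [hv, abs_mul, abs_of_pos (by norm_num : (0:ℝ) < 1/2)]
      linarith
  have hlim : Filter.Tendsto (fun u => 4 * M / k * exp (-k * u)^2) Filter.atTop (nhds 0) := by
    have h1 : Filter.Tendsto (fun u : ℝ => exp (-k * u)) Filter.atTop (nhds 0) :=
      tendsto_exp_atBot.comp (Filter.tendsto_id.const_mul_atTop_of_neg (by linarith))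
    simpa using (h1.pow 2).const_mul (4 * M / k)
  have hlim' : Filter.Tendsto (fun u => 4 * M / k * exp (-k * max u 0)^2) Filter.atTop
      (nhds 0) :=
    hlim.congr' ((Filter.eventually_ge_atTop 0).mono fun u hu => by simp [max_eq_left hu])
  have hc : CauchySeq (fun u => g (max u 0) 0) := by
    refine cauchySeq_of_le_tendsto_0' _ (fun n m hnm => ?_) hlim'
    have := key (max n 0) (max m 0) (le_max_right _ _) (max_le_max_right 0 hnm)
    rw [dist_comm, Real.dist_eq]
    have : 0 ≤ 4 * M / k * exp (-k * max m 0)^2 := by positivity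
    linarith
  obtain ⟨L, hL⟩ := cauchySeq_tendsto_of_complete hc
  refine ⟨L, fun u hu => ?_⟩
  have ht := ((hL.sub_const (g u 0)).abs)
  rw [abs_sub_comm]
  refine le_of_tendsto ht ((Filter.eventually_ge_atTop u).mono fun b hb => ?_)
  have := key u b hu hb
  rw [max_eq_left (hu.trans hb)]
  have : 0 ≤ 4 * M / k * exp (-k * b)^2 := by positivity
  linarith

lemma abs_sub_axis_le (S : IsExtendedSol k g v w) (hk : 0 < k) {M : ℝ}
    (h0 : ∀ r, 0 ≤ r → |w 0 r| ≤ M) {u r : ℝ} (hu : 0 ≤ u) (hr : 0 ≤ r) :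
    |g u r - g u 0| ≤ 16 * M * exp (-k * u)^2 * r := by
  have hB : ∀ x : ℝ, HasDerivAt (fun s => 16 * M * exp (-k * u)^2 * s)
      (16 * M * exp (-k * u)^2) x := fun x => by
    simpa using (hasDerivAt_id x).const_mul (16 * M * exp (-k * u)^2)
  have := abs_sub_le_of_abs_deriv_le hr (S.cont_g_r u).continuousOn
    (fun x _ => (hB x).continuousAt.continuousWithinAt)
    (fun x hx => S.deriv_r u x hu hx.1) (fun x _ => hB x)
    (fun x hx => S.abs_w_le hk h0 hu hx.1.le)
  simpa using this

lemma abs_sub_axis_le_weighted (S : IsExtendedSol k g v w) (hk : 0 < k) {M : ℝ} (hM : 0 ≤ M)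
    (h0 : ∀ r, 0 ≤ r → (1 + r)^2 * |w 0 r| ≤ M) {u r : ℝ} (hu : 0 ≤ u) (hr : 0 ≤ r) :
    |g u r - g u 0| ≤ 16 * M * exp (-k * u)^2 := by
  set K := 16 * M * exp (-k * u)^2 with hK
  have hK0 : 0 ≤ K := by positivity
  have hB : ∀ x : ℝ, 0 ≤ x → HasDerivAt (fun s => K * (-(1 + s)⁻¹)) (K / (1 + x)^2) x := by
    intro x hx
    have h1 : HasDerivAt (fun s : ℝ => 1 + s) 1 x := (hasDerivAt_id x).const_add 1
    refine ((h1.inv (by positivity)).neg.const_mul K).congr_deriv ?_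
    ring
  have := abs_sub_le_of_abs_deriv_le hr (S.cont_g_r u).continuousOn
    (fun x hx => (hB x hx.1).continuousAt.continuousWithinAt)
    (fun x hx => S.deriv_r u x hu hx.1) (fun x hx => hB x hx.1.le)
    (fun x hx => S.abs_w_le_weighted hk h0 hu hx.1.le)
  have h1 : 0 ≤ K * (1 + r)⁻¹ := by positivity
  have h2 : K * (-(1 + r)⁻¹) - K * (-(1 + 0)⁻¹) = K - K * (1 + r)⁻¹ := by
    norm_num
    ring
  linarith

end IsExtendedSol

/-- A `C¹` solution on the quadrant, composed with the retraction of the plane onto the quadrant,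
is an extended solution. -/
lemma IsSol.isExtendedSol {Λ k : ℝ} (hk : k^2 = Λ / 3) {h : ℝ → ℝ → ℝ}
    (hreg : ContDiffOn ℝ 1 (fun q : ℝ × ℝ => h q.1 q.2) (Set.Ici 0 ×ˢ Set.Ici 0))
    (hsol : IsSol Λ h) :
    IsExtendedSol k (fun u r => h (max u 0) (max r 0))
      (fun u r => pderivU h (max u 0) (max r 0)) (fun u r => pderivR h (max u 0) (max r 0)) := by
  set f : ℝ × ℝ → ℝ := fun q => h q.1 q.2 with hf
  set S : Set (ℝ × ℝ) := Set.Ici 0 ×ˢ Set.Ici 0 with hS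
  have hud : UniqueDiffOn ℝ S := (uniqueDiffOn_Ici 0).prod (uniqueDiffOn_Ici 0)
  have hU : ∀ u r : ℝ, 0 ≤ u → 0 ≤ r →
      HasDerivWithinAt (fun u' => h u' r) (fderivWithin ℝ f S (u, r) (1, 0)) (Ici 0) u := by
    intro u r hu hr
    have h1 := (hreg.differentiableOn one_ne_zero (u, r) ⟨hu, hr⟩).hasFDerivWithinAt
    exact h1.comp_hasDerivWithinAt (f := fun u' => (u', r)) u
      ((hasDerivWithinAt_id u _).prodMk (hasDerivWithinAt_const u _ r)) fun x hx => ⟨hx, hr⟩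
  have hR : ∀ u r : ℝ, 0 ≤ u → 0 ≤ r →
      HasDerivWithinAt (fun r' => h u r') (fderivWithin ℝ f S (u, r) (0, 1)) (Ici 0) r := by
    intro u r hu hr
    have h1 := (hreg.differentiableOn one_ne_zero (u, r) ⟨hu, hr⟩).hasFDerivWithinAt
    exact h1.comp_hasDerivWithinAt (f := fun r' => (u, r')) r
      ((hasDerivWithinAt_const r _ u).prodMk (hasDerivWithinAt_id r _)) fun x hx => ⟨hu, hx⟩
  have eU : ∀ u r : ℝ, 0 ≤ u → 0 ≤ r → pderivU h u r = fderivWithin ℝ f S (u, r) (1, 0) :=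
    fun u r hu hr => (hU u r hu hr).derivWithin (uniqueDiffOn_Ici 0 u hu)
  have eR : ∀ u r : ℝ, 0 ≤ u → 0 ≤ r → pderivR h u r = fderivWithin ℝ f S (u, r) (0, 1) :=
    fun u r hu hr => (hR u r hu hr).derivWithin (uniqueDiffOn_Ici 0 r hr)
  have hret : Continuous (fun q : ℝ × ℝ => (max q.1 0, max q.2 0)) := by fun_prop
  have hmem : ∀ q : ℝ × ℝ, (max q.1 0, max q.2 0) ∈ S := fun q =>
    ⟨le_max_right q.1 0, le_max_right q.2 0⟩
  have hfd := hreg.continuousOn_fderivWithin hud le_rfl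
  refine ⟨?_, ?_, ?_, ?_, ?_, ?_⟩
  · exact hreg.continuousOn.comp_continuous hret hmem
  · have := (hfd.clm_apply (continuousOn_const (c := ((1:ℝ), (0:ℝ))))).comp_continuous hret hmem
    exact this.congr fun q => (eU _ _ (le_max_right _ _) (le_max_right _ _)).symm
  · have := (hfd.clm_apply (continuousOn_const (c := ((0:ℝ), (1:ℝ))))).comp_continuous hret hmem
    exact this.congr fun q => (eR _ _ (le_max_right _ _) (le_max_right _ _)).symm
  · intro u r hu hr
    simp only [max_eq_left hu.le, max_eq_left hr]
    rw [eU u r hu.le hr]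
    refine ((hU u r hu.le hr).hasDerivAt (Ici_mem_nhds hu)).congr_of_eventuallyEq ?_
    filter_upwards [lt_mem_nhds hu] with x hx
    rw [max_eq_left hx.le]
  · intro u r hu hr
    simp only [max_eq_left hu, max_eq_left hr.le]
    rw [eR u r hu hr.le]
    refine ((hR u r hu hr.le).hasDerivAt (Ici_mem_nhds hr)).congr_of_eventuallyEq ?_
    filter_upwards [lt_mem_nhds hr] with x hx
    rw [max_eq_left hx.le]
  · intro u r hu hr
    simp only [max_eq_left hu, max_eq_left hr]
    have hint : ∫ s in (0:ℝ)..r, h u (max s 0) = ∫ s in (0:ℝ)..r, h u s := by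
      refine intervalIntegral.integral_congr fun s hs => ?_
      rw [uIcc_of_le hr] at hs
      simp only [max_eq_left hs.1]
    have e := hsol u r hu hr
    rw [hint, hk, e, hbar]
    split_ifs with h0
    · simp [h0]
    · field_simp

/-- Uniform exponential decay to a constant: if `h₀ ∈ C¹([0,∞))` is
bounded with `sup (1+r)^p |h₀'| < ∞` for some `0 ≤ p ≤ 4`, `0 < H ≤ 2√(Λ/3)`, and `h`
is the `C¹` solution of the characteristic problem, then there are constants
`h̲ ∈ ℝ` and `C > 0` with `|h(u,r) - h̲| ≤ C (1+r)^{n(p)} e^{-Hu}`. -/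
theorem wave_dS_exponential_decay_to_constant
    (Λ : ℝ) (hΛ : 0 < Λ) (p : ℝ) (hp0 : 0 ≤ p) (hp4 : p ≤ 4)
    (H : ℝ) (hH0 : 0 < H) (hH : H ≤ 2 * Real.sqrt (Λ / 3))
    (h₀ : ℝ → ℝ) (h₀reg : ContDiffOn ℝ 1 h₀ (Set.Ici 0))
    (h₀bdd : ∃ M : ℝ, ∀ r, 0 ≤ r → |h₀ r| ≤ M)
    (h₀dbdd : ∃ M : ℝ, ∀ r, 0 ≤ r → (1 + r) ^ p * |derivWithin h₀ (Set.Ici 0) r| ≤ M)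
    (h : ℝ → ℝ → ℝ)
    (hreg : ContDiffOn ℝ 1 (fun q : ℝ × ℝ => h q.1 q.2) (Set.Ici 0 ×ˢ Set.Ici 0))
    (hsol : IsSol Λ h) (hinit : ∀ r, 0 ≤ r → h 0 r = h₀ r) :
    ∃ (hlim C : ℝ), 0 < C ∧
      ∀ u r, 0 ≤ u → 0 ≤ r →
        |h u r - hlim| ≤ C * (1 + r) ^ (nExp p) * Real.exp (-H * u) := by
  obtain ⟨k, hk, hk2, hkH⟩ : ∃ k : ℝ, 0 < k ∧ k^2 = Λ / 3 ∧ H ≤ 2 * k :=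
    ⟨Real.sqrt (Λ / 3), Real.sqrt_pos.2 (by positivity), Real.sq_sqrt (by positivity), hH⟩
  have S := hsol.isExtendedSol hk2 hreg
  obtain ⟨M₀, hM₀⟩ := h₀dbdd
  obtain ⟨M, hM, hMM⟩ : ∃ M : ℝ, 0 < M ∧ M₀ ≤ M :=
    ⟨max M₀ 1, lt_max_of_lt_right one_pos, le_max_left _ _⟩
  have hw0 : ∀ r, 0 ≤ r → pderivR h (max 0 0) (max r 0) = derivWithin h₀ (Set.Ici 0) r := by
    intro r hr
    rw [max_self, max_eq_left hr]
    exact derivWithin_congr (fun x hx => hinit x hx) (hinit r hr)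
  have hexp : ∀ u, 0 ≤ u → exp (-k * u)^2 ≤ exp (-H * u) := by
    intro u hu
    rw [← exp_nat_mul]
    apply exp_le_exp.2
    push_cast
    nlinarith
  have hbd : ∀ r, 0 ≤ r → |pderivR h (max 0 0) (max r 0)| ≤ M := by
    intro r hr
    rw [hw0 r hr]
    have h1 : (1:ℝ) ≤ (1 + r)^p := one_le_rpow (by linarith) hp0
    nlinarith [hM₀ r hr, abs_nonneg (derivWithin h₀ (Set.Ici 0) r)]
  obtain ⟨L, hL⟩ := S.exists_limit_axis hk hM.le hbd
  refine ⟨L, 16 * M + 4 * M / k, by positivity, fun u r hu hr => ?_⟩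
  have hL' := hL u hu
  have hE := hexp u hu
  have hEp := exp_pos (-H * u)
  simp only [max_eq_left hu, max_self] at hL'
  have tri : |h u r - L| ≤ |h u r - h u 0| + |h u 0 - L| := abs_sub_le _ _ _
  have hax : 4 * M / k * exp (-k * u)^2 ≤ 4 * M / k * exp (-H * u) := by gcongr
  unfold nExp
  split_ifs with hp
  · have hwt : ∀ r, 0 ≤ r → (1 + r)^2 * |pderivR h (max 0 0) (max r 0)| ≤ M := by
      intro r hr
      rw [hw0 r hr]
      have h1 : (1 + r)^2 ≤ (1 + r)^p := by
        rw [← rpow_two]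
        exact rpow_le_rpow_of_exponent_le (by linarith) hp.le
      nlinarith [hM₀ r hr, abs_nonneg (derivWithin h₀ (Set.Ici 0) r)]
    have hd := S.abs_sub_axis_le_weighted hk hM.le hwt hu hr
    simp only [max_eq_left hu, max_eq_left hr, max_self] at hd
    rw [rpow_zero]
    nlinarith [mul_le_mul_of_nonneg_left hE hM.le]
  · have hd := S.abs_sub_axis_le hk hbd hu hr
    simp only [max_eq_left hu, max_eq_left hr, max_self] at hd
    rw [rpow_two]
    calc |h u r - L| ≤ 16 * M * exp (-H * u) * r + 4 * M / k * exp (-H * u) := by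
          have : 16 * M * exp (-k * u)^2 * r ≤ 16 * M * exp (-H * u) * r := by gcongr
          linarith
      _ ≤ 16 * M * exp (-H * u) * (1 + r)^2 + 4 * M / k * exp (-H * u) * (1 + r)^2 := by
          refine add_le_add ?_ (le_mul_of_one_le_right (by positivity) ?_)
          · gcongr
            nlinarith
          · nlinarith
      _ = (16 * M + 4 * M / k) * (1 + r)^2 * exp (-H * u) := by ring
end

section
/- Let Λ > 0, α := (1/2)√(Λ/3), let u₁ ≥ 0 and r₁ > r_c := √(3/Λ), and let s ↦ r(s) be the characteristic through (u₁,r₁), given by r(s) = √(3/Λ) coth(α(c − s)) with c := u₁ + 2√(3/Λ) arcoth(√(Λ/3) r₁). Then e^{−(Λ/3)∫₀^{u₁} r(s) ds} = (sinh(α(c − u₁))/sinh(α c))², and moreover e^{−(Λ/3)∫₀^{u₁} r(s) ds} ≥ e^{−2α u₁}/(4 α² r₁²). -/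
open Real Set

/-- The hyperbolic cotangent. -/
noncomputable def coth (x : ℝ) : ℝ := Real.cosh x / Real.sinh x

/-- The inverse of `coth` on `(1,∞)`. -/
noncomputable def arcoth (x : ℝ) : ℝ := (1/2) * Real.log ((x + 1) / (x - 1))

/-- `coth (arcoth x) = x` for `1 < x`, with the denominator cleared. -/
theorem cosh_arcoth_eq_mul_sinh_arcoth {x : ℝ} (hx : 1 < x) :
    Real.cosh (arcoth x) = x * Real.sinh (arcoth x) := by
  have hx' : 0 < x - 1 := sub_pos.2 hx
  have hq : 0 < (x + 1) / (x - 1) := div_pos (by linarith) hx'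
  have h_exp : Real.exp (arcoth x) * Real.exp (arcoth x) = (x + 1) / (x - 1) := by
    rw [← Real.exp_add, arcoth, ← add_mul, add_halves, one_mul, Real.exp_log hq]
  have h_inv : Real.exp (arcoth x) * Real.exp (-arcoth x) = 1 := by
    rw [← Real.exp_add, add_neg_cancel, Real.exp_zero]
  rw [eq_div_iff hx'.ne'] at h_exp
  rw [Real.cosh_eq, Real.sinh_eq]
  refine mul_left_cancel₀ (Real.exp_pos (arcoth x)).ne' ?_
  linear_combination (-1 / 2) * h_exp + ((1 + x) / 2) * h_inv

theorem arcoth_pos {x : ℝ} (hx : 1 < x) : 0 < arcoth x := by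
  have hx' : 0 < x - 1 := sub_pos.2 hx
  exact mul_pos one_half_pos (Real.log_pos ((one_lt_div hx').2 (by linarith)))

theorem hasDerivAt_log_sinh_mul_sub {a c s : ℝ} (h : 0 < a * (c - s)) :
    HasDerivAt (fun t => Real.log (Real.sinh (a * (c - t)))) (-a * coth (a * (c - s))) s := by
  have h_lin : HasDerivAt (fun t => a * (c - t)) (a * -1) s :=
    ((hasDerivAt_id s).const_sub c).const_mul a
  convert h_lin.sinh.log (Real.sinh_pos_iff.2 h).ne' using 1
  rw [coth]
  ring

theorem mul_integral_coth_mul_sub {a c u : ℝ} (ha : 0 < a) (hu : 0 ≤ u) (hcu : u < c) :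
    a * ∫ s in (0 : ℝ)..u, coth (a * (c - s)) =
      Real.log (Real.sinh (a * c)) - Real.log (Real.sinh (a * (c - u))) := by
  have h_pos : ∀ s ∈ Set.uIcc 0 u, 0 < a * (c - s) := fun s hs => by
    rw [Set.uIcc_of_le hu] at hs
    exact mul_pos ha (by linarith [hs.2])
  have h_cont : ContinuousOn (fun s => -a * coth (a * (c - s))) (Set.uIcc 0 u) := by
    unfold coth
    refine continuousOn_const.mul (ContinuousOn.div (by fun_prop) (by fun_prop) fun s hs => ?_)
    exact (Real.sinh_pos_iff.2 (h_pos s hs)).ne'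
  have h_ftc := intervalIntegral.integral_eq_sub_of_hasDerivAt
    (fun s hs => hasDerivAt_log_sinh_mul_sub (h_pos s hs)) h_cont.intervalIntegrable
  rw [intervalIntegral.integral_const_mul, sub_zero] at h_ftc
  linarith

theorem sinh_add_le_exp_mul_cosh (x y : ℝ) :
    Real.sinh (x + y) ≤ Real.exp y * Real.cosh x := by
  rw [Real.sinh_eq, Real.cosh_eq, Real.exp_add]
  have h₁ := Real.exp_pos (-(x + y))
  have h₂ := mul_pos (Real.exp_pos y) (Real.exp_pos (-x))
  linarith

/-- For `u₁ ≥ 0`, `r₁ > r_c = √(3/Λ)`, `α = (1/2)√(Λ/3)` and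
`c = u₁ + 2√(3/Λ) arcoth(√(Λ/3) r₁)`, the characteristic
`s ↦ √(3/Λ) coth(α(c-s))` through `(u₁,r₁)` satisfies
`e^{-(Λ/3)∫₀^{u₁} r(s) ds} = (sinh(α(c-u₁))/sinh(αc))²` and
`e^{-(Λ/3)∫₀^{u₁} r(s) ds} ≥ e^{-2αu₁}/(4α²r₁²)`. -/
theorem cosmological_characteristic_exponential
    (Λ : ℝ) (hΛ : 0 < Λ) (u₁ r₁ : ℝ) (hu₁ : 0 ≤ u₁)
    (hr₁ : Real.sqrt (3 / Λ) < r₁)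
    (α : ℝ) (hα : α = (1/2) * Real.sqrt (Λ / 3))
    (c : ℝ) (hc : c = u₁ + 2 * Real.sqrt (3 / Λ) * arcoth (Real.sqrt (Λ / 3) * r₁)) :
    Real.exp (-(Λ/3) * ∫ s in (0:ℝ)..u₁, Real.sqrt (3 / Λ) * coth (α * (c - s)))
        = (Real.sinh (α * (c - u₁)) / Real.sinh (α * c)) ^ 2 ∧
      Real.exp (-(Λ/3) * ∫ s in (0:ℝ)..u₁, Real.sqrt (3 / Λ) * coth (α * (c - s)))
        ≥ Real.exp (-2 * α * u₁) / (4 * α ^ 2 * r₁ ^ 2) := by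
  have hk : 0 < Real.sqrt (Λ / 3) := Real.sqrt_pos.2 (by positivity)
  have hk_sq : Λ / 3 = Real.sqrt (Λ / 3) ^ 2 := (Real.sq_sqrt (by positivity)).symm
  have hK : Real.sqrt (3 / Λ) = (Real.sqrt (Λ / 3))⁻¹ := by rw [← Real.sqrt_inv, inv_div]
  rw [hK] at hr₁ hc ⊢
  generalize Real.sqrt (Λ / 3) = k at *
  rw [hk_sq]
  have hx : 1 < k * r₁ := (inv_lt_iff_one_lt_mul₀' hk).1 hr₁
  have hA := arcoth_pos hx
  have h_cosh := cosh_arcoth_eq_mul_sinh_arcoth hx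
  generalize arcoth (k * r₁) = A at *
  have hα_pos : 0 < α := by rw [hα]; positivity
  have hcu : u₁ < c := by
    rw [hc]
    exact lt_add_of_pos_right _ (by positivity)
  have hαcu : α * (c - u₁) = A := by
    rw [hα, hc]
    field_simp
    ring
  have hαc : α * c = A + α * u₁ := by linear_combination hαcu
  have h_sinh : 0 < Real.sinh A := Real.sinh_pos_iff.2 hA
  have h_sinh_c : 0 < Real.sinh (α * c) := by
    rw [hαc, Real.sinh_pos_iff]
    positivity
  have h_eq : Real.exp (-(k ^ 2) * ∫ s in (0:ℝ)..u₁, k⁻¹ * coth (α * (c - s)))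
      = (Real.sinh (α * (c - u₁)) / Real.sinh (α * c)) ^ 2 := by
    have h_int := mul_integral_coth_mul_sub hα_pos hu₁ hcu
    have h_arg : -(k ^ 2) * ∫ s in (0:ℝ)..u₁, k⁻¹ * coth (α * (c - s)) =
        (2 : ℕ) * Real.log (Real.sinh A / Real.sinh (α * c)) := by
      rw [hαcu] at h_int
      rw [Real.log_div h_sinh.ne' h_sinh_c.ne', intervalIntegral.integral_const_mul,
        ← mul_assoc, show -(k ^ 2) * k⁻¹ = -2 * α by rw [hα]; field_simp]
      push_cast
      linear_combination -2 * h_int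
    rw [h_arg, hαcu, Real.exp_nat_mul, Real.exp_log (div_pos h_sinh h_sinh_c)]
  refine ⟨h_eq, ?_⟩
  rw [h_eq, hαcu, ge_iff_le]
  have h_rhs : Real.exp (-2 * α * u₁) / (4 * α ^ 2 * r₁ ^ 2) =
      (1 / (Real.exp (α * u₁) * (k * r₁))) ^ 2 := by
    rw [show -2 * α * u₁ = -((2 : ℕ) * (α * u₁)) by push_cast; ring, Real.exp_neg,
      Real.exp_nat_mul, hα]
    field_simp
    norm_num
  have hx_pos : 0 < k * r₁ := one_pos.trans hx
  rw [h_rhs]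
  refine pow_le_pow_left₀ (by positivity) ?_ 2
  rw [div_le_div_iff₀ (by positivity) h_sinh_c, hαc]
  have h_bound := sinh_add_le_exp_mul_cosh A (α * u₁)
  rw [h_cosh] at h_bound
  linarith
end

section
/- Let α > 0 and 0 ≤ u₁ < c, and set r₁ := (1/(2α)) coth(α(c − u₁)) and r₀ := (1/(2α)) coth(α c). Then ((1 + r₁)/(1 + r₀)) · (sinh(α(c − u₁))/sinh(α c)) ≤ 2 (2α + 1) e^{−α u₁}. -/
open Real Set

/-- For `α > 0` and `0 ≤ u₁ < c`, with
`r₁ = (1/(2α)) coth(α(c-u₁))` and `r₀ = (1/(2α)) coth(αc)`,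
`((1+r₁)/(1+r₀)) (sinh(α(c-u₁))/sinh(αc)) ≤ 2(2α+1) e^{-αu₁}`. -/
theorem characteristic_weight_estimate
    (α c u₁ : ℝ) (hα : 0 < α) (hu₁ : 0 ≤ u₁) (huc : u₁ < c)
    (r₁ r₀ : ℝ)
    (hr₁ : r₁ = (1 / (2 * α)) * coth (α * (c - u₁)))
    (hr₀ : r₀ = (1 / (2 * α)) * coth (α * c)) :
    ((1 + r₁) / (1 + r₀)) * (Real.sinh (α * (c - u₁)) / Real.sinh (α * c))
      ≤ 2 * (2 * α + 1) * Real.exp (-α * u₁) := by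
  have hx : 0 < α * (c - u₁) := mul_pos hα (sub_pos.mpr huc)
  have hy : 0 < α * c := mul_pos hα (hu₁.trans_lt huc)
  have hxy : Real.exp (α * (c - u₁)) = Real.exp (-α * u₁) * Real.exp (α * c) := by
    rw [← Real.exp_add]
    ring_nf
  have hsx := Real.sinh_pos_iff.mpr hx
  have hsy := Real.sinh_pos_iff.mpr hy
  have hcy := Real.cosh_pos (α * c)
  have hratio : ((1 + r₁) / (1 + r₀)) * (Real.sinh (α * (c - u₁)) / Real.sinh (α * c)) =
      (2 * α * Real.sinh (α * (c - u₁)) + Real.cosh (α * (c - u₁))) /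
        (2 * α * Real.sinh (α * c) + Real.cosh (α * c)) := by
    have hr₁' : 1 + r₁ = (2 * α * Real.sinh (α * (c - u₁)) + Real.cosh (α * (c - u₁))) /
        (2 * α * Real.sinh (α * (c - u₁))) := by
      rw [hr₁, coth]
      field_simp
    have hr₀' : 1 + r₀ = (2 * α * Real.sinh (α * c) + Real.cosh (α * c)) /
        (2 * α * Real.sinh (α * c)) := by
      rw [hr₀, coth]
      field_simp
    have hden : 2 * α * Real.sinh (α * c) + Real.cosh (α * c) ≠ 0 := by positivity
    rw [hr₁', hr₀']
    generalize 2 * α * Real.sinh (α * c) + Real.cosh (α * c) = d at hden ⊢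
    generalize 2 * α * Real.sinh (α * (c - u₁)) + Real.cosh (α * (c - u₁)) = n
    field_simp
  have hcosh : Real.cosh (α * (c - u₁)) ≤ Real.exp (α * (c - u₁)) := by
    linarith [Real.cosh_add_sinh (α * (c - u₁))]
  have hsinh : Real.sinh (α * (c - u₁)) ≤ Real.exp (α * (c - u₁)) := by
    linarith [Real.cosh_add_sinh (α * (c - u₁)), Real.cosh_pos (α * (c - u₁))]
  have hexp : Real.exp (α * c) ≤ 2 * (2 * α * Real.sinh (α * c) + Real.cosh (α * c)) := by
    have : 0 < 2 * α * Real.sinh (α * c) := by positivity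
    linarith [Real.cosh_add_sinh (α * c), Real.sinh_lt_cosh (α * c)]
  rw [hratio, div_le_iff₀ (by positivity)]
  calc 2 * α * Real.sinh (α * (c - u₁)) + Real.cosh (α * (c - u₁))
      ≤ 2 * α * Real.exp (α * (c - u₁)) + Real.exp (α * (c - u₁)) := by gcongr
    _ = (2 * α + 1) * Real.exp (-α * u₁) * Real.exp (α * c) := by
      rw [hxy]
      ring
    _ ≤ (2 * α + 1) * Real.exp (-α * u₁) *
        (2 * (2 * α * Real.sinh (α * c) + Real.cosh (α * c))) := by gcongr
    _ = 2 * (2 * α + 1) * Real.exp (-α * u₁) *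
        (2 * α * Real.sinh (α * c) + Real.cosh (α * c)) := by ring
end
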